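/- arXiv:2311.09397 — 3 statements merged into one kernel-verified Lean document; each statement's English description precedes it below -/
import Mathlib

section
/- Entropy of a shift-invariant measure is dominated by the entropy of its associated Markov kernel: Let T be a forward expansive correspondence on a compact metric space (X,d), ν a σ-invariant Borel probability measure on O_ω(T), Q a transition probability kernel on X supported by T, and μ a Q-invariant Borel probability measure on X such that ν∘π₁₂^{−1} = μQ^{[1]}, where π₁₂ : O_ω(T) → X×X is the projection π₁₂(x₁,x₂,…) := (x₁,x₂). Then h_ν(σ) ≤ h_μ(Q), where h_ν(σ) is the Kolmogorov–Sinai entropy of the shift σ on O_ω(T) with respect to ν. -/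
open Filter MeasureTheory Set
open scoped Topology ENNReal Classical

namespace Corr

variable {X : Type*}

/-- `T` is a correspondence on `X`: each `T x` is a nonempty closed subset of `X`
and the graph `O₂(T)` is closed in `X × X`. -/
def IsCorrespondence [MetricSpace X] (T : X → Set X) : Prop :=
  (∀ x, (T x).Nonempty) ∧ (∀ x, IsClosed (T x)) ∧ IsClosed {p : X × X | p.2 ∈ T p.1}

/-- The graph `O₂(T) = {(x₁,x₂) : x₂ ∈ T x₁}`. -/
def graph2 (T : X → Set X) : Set (X × X) := {p | p.2 ∈ T p.1}

/-- The orbit space `O_ω(T)` (0-indexed sequences). -/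
def orbitSpace (T : X → Set X) : Set (ℕ → X) := {x | ∀ k, x (k + 1) ∈ T (x k)}

/-- `x : Fin (n+1) → X` is an element of `O_{n+1}(T)`. -/
def IsFinOrbit (T : X → Set X) {n : ℕ} (x : Fin (n + 1) → X) : Prop :=
  ∀ i : Fin n, x i.succ ∈ T (x i.castSucc)

/-- `O_{n+1}(T)` as a subset of `Fin (n+1) → X` (with the sup metric). -/
def finOrbits (T : X → Set X) (n : ℕ) : Set (Fin (n + 1) → X) := {x | IsFinOrbit T x}

/-- The first `n` entries of `x : ℕ → X` form an orbit in `O_n(T)`. -/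
def IsOrbitSeg (T : X → Set X) (n : ℕ) (x : ℕ → X) : Prop :=
  ∀ i : ℕ, i + 1 < n → x (i + 1) ∈ T (x i)

/-- The shift on sequences. -/
def shiftSeq : (ℕ → X) → ℕ → X := fun x k => x (k + 1)

/-- The shift `σ` on the orbit space `O_ω(T)`. -/
def shiftOrb (T : X → Set X) : ↥(orbitSpace T) → ↥(orbitSpace T) :=
  fun x => ⟨shiftSeq x.1, fun k => x.2 (k + 1)⟩

/-- The metric `d_ω` on sequences (`k`-th coordinate, `k ≥ 0`, has weight `2^{-(k+1)}`). -/
noncomputable def dOmega [MetricSpace X] (x y : ℕ → X) : ℝ :=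
  ∑' k : ℕ, (1 / 2 : ℝ) ^ (k + 1) * (dist (x k) (y k) / (1 + dist (x k) (y k)))

/-- `T` is forward expansive with expansive constant `ε`. -/
def IsFwdExpansiveWith [MetricSpace X] (T : X → Set X) (ε : ℝ) : Prop :=
  0 < ε ∧ ∀ x ∈ orbitSpace T, ∀ y ∈ orbitSpace T, x ≠ y → ∃ n : ℕ, ε < dist (x n) (y n)

/-- `T` is forward expansive. -/
def IsFwdExpansive [MetricSpace X] (T : X → Set X) : Prop :=
  ∃ ε : ℝ, IsFwdExpansiveWith T ε

/-- Extension by `0` of a potential `φ : O₂(T) → ℝ` to `X × X`. -/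
noncomputable def ext2 (T : X → Set X) (φ : ↥(graph2 T) → ℝ) : X × X → ℝ :=
  fun p => if h : p ∈ graph2 T then φ ⟨p, h⟩ else 0

/-- The Birkhoff sum `S_n φ` along an element of `X^{n+1}` (equal to the sum
`∑_{i=1}^n φ(x_i, x_{i+1})` on orbits in `O_{n+1}(T)`). -/
noncomputable def birkhoff (T : X → Set X) (φ : ↥(graph2 T) → ℝ) {n : ℕ}
    (x : Fin (n + 1) → X) : ℝ :=
  ∑ i : Fin n, ext2 T φ (x i.castSucc, x i.succ)

/-- `E` is `ε`-separated: distinct points of `E` are at distance `≥ ε`. -/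
def eSep {Y : Type*} [PseudoMetricSpace Y] (ε : ℝ) (E : Set Y) : Prop :=
  ∀ x ∈ E, ∀ y ∈ E, x ≠ y → ε ≤ dist x y

/-- `∑_{x ∈ E} exp (S_n φ (x))` for a set `E` of orbit segments. -/
noncomputable def orbSum (T : X → Set X) (φ : ↥(graph2 T) → ℝ) (n : ℕ)
    (E : Set (Fin (n + 1) → X)) : ℝ≥0∞ :=
  ∑' x : E, ENNReal.ofReal (Real.exp (birkhoff T φ (x : Fin (n + 1) → X)))

/-- Logarithm `ℝ≥0∞ → EReal`, with `log 0 = ⊥` and `log ⊤ = ⊤`. -/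
noncomputable def elog (x : ℝ≥0∞) : EReal :=
  if x = 0 then ⊥ else if x = ⊤ then ⊤ else ((Real.log x.toReal : ℝ) : EReal)

/-- `sup_E ∑_{x ∈ E} exp (S_n φ (x))` over `ε`-separated subsets `E` of `O_{n+1}(T)`. -/
noncomputable def sepSup [MetricSpace X] (T : X → Set X) (φ : ↥(graph2 T) → ℝ)
    (n : ℕ) (ε : ℝ) : ℝ≥0∞ :=
  ⨆ (E : Set (Fin (n + 1) → X)) (_ : E ⊆ finOrbits T n) (_ : eSep ε E), orbSum T φ n E

/-- `inf_F ∑_{x ∈ F} exp (S_n φ (x))` over `ε`-spanning subsets `F` of `O_{n+1}(T)`. -/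
noncomputable def spanInf [MetricSpace X] (T : X → Set X) (φ : ↥(graph2 T) → ℝ)
    (n : ℕ) (ε : ℝ) : ℝ≥0∞ :=
  ⨅ (E : Set (Fin (n + 1) → X)) (_ : E ⊆ finOrbits T n)
    (_ : ∀ y ∈ finOrbits T n, ∃ x ∈ E, dist x y < ε), orbSum T φ n E

/-- `limsup_n (1/n) log sup_E ∑_{x ∈ E} exp (S_n φ (x))` for a fixed `ε`. -/
noncomputable def pressSepEps [MetricSpace X] (T : X → Set X) (φ : ↥(graph2 T) → ℝ)
    (ε : ℝ) : EReal :=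
  Filter.limsup (fun n : ℕ => (((n : ℝ)⁻¹ : ℝ) : EReal) * elog (sepSup T φ n ε)) atTop

/-- The spanning-set analogue of `pressSepEps`. -/
noncomputable def pressSpanEps [MetricSpace X] (T : X → Set X) (φ : ↥(graph2 T) → ℝ)
    (ε : ℝ) : EReal :=
  Filter.limsup (fun n : ℕ => (((n : ℝ)⁻¹ : ℝ) : EReal) * elog (spanInf T φ n ε)) atTop

/-- The topological pressure `P(T,φ)` of a correspondence: the limit as `ε → 0⁺`
(equivalently, since `pressSepEps` is antitone in `ε`, the limsup) of
`limsup_n (1/n) log sup_E ∑_{x∈E} exp (S_nφ(x))` over `ε`-separated sets `E ⊆ O_{n+1}(T)`. -/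
noncomputable def pressure [MetricSpace X] (T : X → Set X) (φ : ↥(graph2 T) → ℝ) : EReal :=
  Filter.limsup (fun ε : ℝ => pressSepEps T φ ε) (𝓝[>] (0 : ℝ))

section MeasureTheoryDefs

variable [MeasurableSpace X]

/-- A transition probability kernel on `X`: a measurable assignment of probability
measures. -/
def IsTransKernel (Q : X → Measure X) : Prop :=
  Measurable Q ∧ ∀ x, IsProbabilityMeasure (Q x)

/-- The kernel `Q` is supported by the correspondence `T`. -/
def SupportedBy (T : X → Set X) (Q : X → Measure X) : Prop :=
  ∀ x, Q x (T x) = 1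

/-- `markovLaw μ Q n = μQ^{[n]}`, the law on `X^{n+1}` of the first `n+1` states of the
Markov chain with initial law `μ` and transition kernel `Q`. -/
noncomputable def markovLaw (μ : Measure X) (Q : X → Measure X) :
    (n : ℕ) → Measure (Fin (n + 1) → X)
  | 0 => μ.map fun x => fun _ : Fin 1 => x
  | n + 1 => (markovLaw μ Q n).bind fun x => (Q (x (Fin.last n))).map fun y => Fin.snoc x y

/-- `μQ^{[1]}` as a measure on `X × X`. -/
noncomputable def step2 (μ : Measure X) (Q : X → Measure X) : Measure (X × X) :=
  μ.bind fun x => (Q x).map fun y => (x, y)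

/-- `ν` is the law `μQ^ω` on `X^ℕ` of the full trajectory of the Markov chain with
initial law `μ` and transition kernel `Q`. -/
def IsTrajLaw (μ : Measure X) (Q : X → Measure X) (ν : Measure (ℕ → X)) : Prop :=
  IsProbabilityMeasure ν ∧
    ∀ n : ℕ, ν.map (fun x (i : Fin (n + 1)) => x i.val) = markovLaw μ Q n

end MeasureTheoryDefs

/-- The entropy `H_ν(𝒜)` of the finite measurable partition of `Y` given by the fibers
of `p : Y → I`. -/
noncomputable def partEntropy {Y : Type*} [MeasurableSpace Y] (ν : Measure Y)
    {I : Type*} [Fintype I] (p : Y → I) : ℝ :=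
  ∑ i : I, Real.negMulLog ((ν (p ⁻¹' {i})).toReal)

/-- The measure-theoretic entropy `h_μ(Q)` of a transition probability kernel:
`sup_𝒜 lim_n (1/n) H_{μQ^{[n-1]}}(𝒜ⁿ)` over finite measurable partitions `𝒜` of `X`. -/
noncomputable def kernelEntropy [MeasurableSpace X] (μ : Measure X) (Q : X → Measure X) :
    EReal :=
  ⨆ (m : ℕ) (p : X → Fin m) (_ : Measurable p),
    ((Filter.limsup
        (fun n : ℕ => (n : ℝ)⁻¹ * partEntropy (markovLaw μ Q (n - 1)) fun x => p ∘ x)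
        atTop : ℝ) : EReal)

/-- The Kolmogorov–Sinai entropy `h_ν(g)` of a measurable map `g`:
`sup_𝒫 lim_n (1/n) H_ν(⋁_{i<n} g^{-i}𝒫)` over finite measurable partitions `𝒫`. -/
noncomputable def ksEntropy {Y : Type*} [MeasurableSpace Y] (ν : Measure Y) (g : Y → Y) :
    EReal :=
  ⨆ (m : ℕ) (p : Y → Fin m) (_ : Measurable p),
    ((Filter.limsup
        (fun n : ℕ => (n : ℝ)⁻¹ * partEntropy ν fun y => fun i : Fin n => p (g^[i.val] y))
        atTop : ℝ) : EReal)

/-- The energy term `∫_X ∫_{T(x)} φ(x,y) dQ_x(y) dμ(x)`. -/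
noncomputable def energyInt [MeasurableSpace X] (T : X → Set X) (φ : ↥(graph2 T) → ℝ)
    (Q : X → Measure X) (μ : Measure X) : ℝ :=
  ∫ x, (∫ y in T x, ext2 T φ (x, y) ∂(Q x)) ∂μ

/-- `sup_{Q,μ} { h_μ(Q) + ∫∫ φ dQ dμ }` over transition probability kernels `Q`
supported by `T` and `Q`-invariant Borel probability measures `μ`. -/
noncomputable def varSup [MetricSpace X] [MeasurableSpace X] (T : X → Set X)
    (φ : ↥(graph2 T) → ℝ) : EReal :=
  ⨆ (Q : X → Measure X) (_ : IsTransKernel Q) (_ : SupportedBy T Q) (μ : Measure X)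
    (_ : IsProbabilityMeasure μ) (_ : μ.bind Q = μ),
    kernelEntropy μ Q + ((energyInt T φ Q μ : ℝ) : EReal)

/-- `(μ, Q)` is an equilibrium state for `T` and `φ`. -/
def IsEquilibrium [MetricSpace X] [MeasurableSpace X] (T : X → Set X) (φ : ↥(graph2 T) → ℝ)
    (μ : Measure X) (Q : X → Measure X) : Prop :=
  IsTransKernel Q ∧ SupportedBy T Q ∧ IsProbabilityMeasure μ ∧ μ.bind Q = μ ∧
    pressure T φ = kernelEntropy μ Q + ((energyInt T φ Q μ : ℝ) : EReal)

/-- `H(ρ) = -∑_y ρ{y} log ρ{y}` if `ρ` is supported on a countable set, `∞` otherwise. -/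
noncomputable def atomEntropy {Y : Type*} [MeasurableSpace Y] (ρ : Measure Y) : ℝ≥0∞ :=
  if ∃ A : Set Y, A.Countable ∧ MeasurableSet A ∧ ρ A = 1 then
    ∑' y : Y, ENNReal.ofReal (Real.negMulLog ((ρ {y}).toReal))
  else ⊤

/-- `R` is a backward conditional transition probability kernel of `ν` from `X₂` to `X₁`
supported on `M`. -/
def IsBackwardCondKernel {X₁ X₂ : Type*} [MeasurableSpace X₁] [MeasurableSpace X₂]
    (ν : Measure (X₁ × X₂)) (M : Set (X₁ × X₂)) (R : X₂ → Measure X₁) : Prop :=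
  Measurable R ∧ (∀ x, IsProbabilityMeasure (R x)) ∧
    (∀ x₂ ∈ Prod.snd '' M, R x₂ {x₁ | (x₁, x₂) ∈ M} = 1) ∧
    ∀ C : Set (X₁ × X₂), MeasurableSet C →
      ν C = ∫⁻ x₂, R x₂ {x₁ | (x₁, x₂) ∈ C} ∂(ν.map Prod.snd)

/-- `m(k) = ∑_{l<k} (m_l + p_l)`, the offsets in the specification property. -/
def specShift {n : ℕ} (m p : Fin n → ℕ) (k : ℕ) : ℕ :=
  ∑ l : Fin n, if l.val < k then m l + p l else 0

/-- The specification property for correspondences. -/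
def HasSpecification [MetricSpace X] (T : X → Set X) : Prop :=
  ∀ ε : ℝ, 0 < ε → ∃ M : ℕ, ∀ (n : ℕ) (m p : Fin n → ℕ) (x : Fin n → ℕ → X),
    (∀ j, 1 ≤ m j) → (∀ j, M < p j) → (∀ j, IsOrbitSeg T (m j) (x j)) →
    ∃ z ∈ orbitSpace T, ∀ j : Fin n, ∀ i < m j,
      dist (z (specShift m p j.val + i)) (x j i) < ε

/-- `φ` is Bowen summable w.r.t. the expansive constant `ε`, i.e.
`sup_n K_{φ,T}(ε,n) < ∞`. -/
def BowenSummableWith [MetricSpace X] (T : X → Set X) (φ : ↥(graph2 T) → ℝ) (ε : ℝ) : Prop :=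
  ∃ C : ℝ, ∀ (n : ℕ) (x y : Fin (n + 1) → X), IsFinOrbit T x → IsFinOrbit T y →
    (∀ k, dist (x k) (y k) < ε) → |birkhoff T φ x - birkhoff T φ y| ≤ C

/-- Forward image `T(A) = ⋃_{x ∈ A} T(x)`. -/
def corrImage (T : X → Set X) (A : Set X) : Set X := ⋃ x ∈ A, T x

/-- Iterated forward images `Tⁿ(A)`. -/
def corrIter (T : X → Set X) : ℕ → Set X → Set X
  | 0, A => A
  | n + 1, A => corrImage T (corrIter T n A)

/-- Backward image `T^{-1}(A) = {y : A ∩ T(y) ≠ ∅}`. -/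
def corrPre (T : X → Set X) (A : Set X) : Set X := {y | (A ∩ T y).Nonempty}

/-- Iterated backward images `T^{-n}(A)`. -/
def corrPreIter (T : X → Set X) : ℕ → Set X → Set X
  | 0, A => A
  | n + 1, A => corrPre T (corrPreIter T n A)

/-- `T` is an open correspondence. -/
def IsOpenCorr [MetricSpace X] (T : X → Set X) : Prop :=
  ∀ U : Set X, IsOpen U → IsOpen (corrImage T U)

/-- `T` is strongly transitive: `⋃_{n ≥ 1} T^{-n}(x)` is dense for every `x`. -/
def StronglyTransitive [MetricSpace X] (T : X → Set X) : Prop :=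
  ∀ x : X, Dense (⋃ n : ℕ, corrPreIter T (n + 1) {x})

/-- `T` is distance-expanding. -/
def DistanceExpanding [MetricSpace X] (T : X → Set X) : Prop :=
  ∃ lam : ℝ, 1 < lam ∧ ∃ η : ℝ, 0 < η ∧ ∃ n : ℕ, 1 ≤ n ∧
    ∀ x y : X, dist x y ≤ η →
      ∀ x' ∈ corrIter T n {x}, ∀ y' ∈ corrIter T n {y}, lam * dist x y ≤ dist x' y'

/-- `T` is topologically exact. -/
def TopologicallyExact [MetricSpace X] (T : X → Set X) : Prop :=
  ∀ U : Set X, IsOpen U → U.Nonempty → ∃ N : ℕ, 1 ≤ N ∧ corrIter T N U = Set.univ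

/-- `φ : O₂(T) → ℝ` is Hölder continuous w.r.t. the metric
`d₂((x₁,x₂),(y₁,y₂)) = max (d x₁ y₁) (d x₂ y₂)` (the product metric on `X × X`). -/
def HolderOn [MetricSpace X] (T : X → Set X) (φ : ↥(graph2 T) → ℝ) : Prop :=
  ∃ C : ℝ, 0 < C ∧ ∃ α : ℝ, 0 < α ∧ α ≤ 1 ∧
    ∀ a b : ↥(graph2 T), |φ a - φ b| ≤ C * dist (a : X × X) (b : X × X) ^ α

/-- `O_{-n}(x)`: backward orbits of length `n+1` terminating at `x`. -/
def backOrbits (T : X → Set X) (n : ℕ) (x : X) : Set (Fin (n + 1) → X) :=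
  {y | IsFinOrbit T y ∧ y (Fin.last n) = x}

/-- The lift `φ̃(x₁,x₂,…) = φ(x₁,x₂)` of a potential to the orbit space. -/
def liftPhi (T : X → Set X) (φ : ↥(graph2 T) → ℝ) : ↥(orbitSpace T) → ℝ :=
  fun x => φ ⟨(x.1 0, x.1 1), x.2 0⟩

/-- The Ruelle operator `L_{φ̃}` for the shift on the orbit space:
`(L_{φ̃} Φ)(x) = ∑_{σ(y)=x} Φ(y) exp(φ̃(y))`. -/
noncomputable def ruelleL (T : X → Set X) (φ : ↥(graph2 T) → ℝ)
    (Φ : ↥(orbitSpace T) → ℝ) : ↥(orbitSpace T) → ℝ :=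
  fun x => ∑ᶠ (y : ↥(orbitSpace T)) (_ : shiftOrb T y = x), Φ y * Real.exp (liftPhi T φ y)

/-- Classical topological pressure of a map `g : Y → Y` w.r.t. a potential `ψ` and an
explicit distance function `ρ`, via `(n,ε)`-separated sets. -/
noncomputable def dynPressure {Y : Type*} (ρ : Y → Y → ℝ) (g : Y → Y) (ψ : Y → ℝ) : EReal :=
  Filter.limsup (fun ε : ℝ =>
    Filter.limsup (fun n : ℕ => (((n : ℝ)⁻¹ : ℝ) : EReal) * elog
      (⨆ (E : Set Y) (_ : ∀ x ∈ E, ∀ y ∈ E, x ≠ y → ∃ j < n, ε ≤ ρ (g^[j] x) (g^[j] y)),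
        ∑' x : E, ENNReal.ofReal (Real.exp (∑ j ∈ Finset.range n, ψ (g^[j] (x : Y))))))
      atTop) (𝓝[>] (0 : ℝ))

end Corr
namespace Corr

section ConditionalEntropy

open ProbabilityTheory

variable {Ω : Type*} {m m₁ m₂ : MeasurableSpace Ω} [mΩ : MeasurableSpace Ω]

/-- The entropy of the finite partition into fibers of `p`, conditioned on the σ-algebra `m`. -/
noncomputable def condEntropy (ρ : Measure Ω) {I : Type*} [Fintype I] (p : Ω → I)
    (m : MeasurableSpace Ω) : ℝ :=
  ∑ i : I, ∫ ω, Real.negMulLog ((ρ[(p ⁻¹' {i}).indicator (fun _ => (1 : ℝ)) | m]) ω) ∂ρ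

lemma negMulLog_mem_Icc {x : ℝ} (hx : x ∈ Icc (0 : ℝ) 1) : Real.negMulLog x ∈ Icc (0 : ℝ) 1 :=
  ⟨Real.negMulLog_nonneg hx.1 hx.2,
    (Real.negMulLog_le_one_sub_self hx.1).trans (by linarith [hx.1])⟩

lemma condExp_indicator_mem_Icc (ρ : Measure Ω) [IsProbabilityMeasure ρ]
    (hm : m ≤ mΩ) {A : Set Ω} (hA : MeasurableSet A) :
    ∀ᵐ ω ∂ρ, (ρ[A.indicator (fun _ => (1 : ℝ)) | m]) ω ∈ Icc (0 : ℝ) 1 := by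
  have hint : Integrable (A.indicator (fun _ => (1 : ℝ))) ρ := (integrable_const 1).indicator hA
  have h0 : 0 ≤ᵐ[ρ] ρ[A.indicator (fun _ => (1 : ℝ)) | m] :=
    condExp_nonneg (ae_of_all _ fun ω => indicator_nonneg (fun _ _ => zero_le_one) ω)
  have h1 : ρ[A.indicator (fun _ => (1 : ℝ)) | m] ≤ᵐ[ρ] ρ[fun _ => (1 : ℝ) | m] :=
    condExp_mono hint (integrable_const 1)
      (ae_of_all _ fun ω => indicator_le_self' (fun _ _ => zero_le_one) ω)
  rw [condExp_const hm] at h1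
  filter_upwards [h0, h1] with ω h0 h1 using ⟨h0, h1⟩

lemma aestronglyMeasurable_negMulLog_condExp (ρ : Measure Ω)
    (hm : m ≤ mΩ) (f : Ω → ℝ) :
    AEStronglyMeasurable (fun ω => Real.negMulLog ((ρ[f | m]) ω)) ρ :=
  Real.continuous_negMulLog.comp_aestronglyMeasurable
    (stronglyMeasurable_condExp.mono hm).aestronglyMeasurable

lemma integrable_negMulLog_condExp (ρ : Measure Ω) [IsProbabilityMeasure ρ]
    (hm : m ≤ mΩ) {A : Set Ω} (hA : MeasurableSet A) :
    Integrable
      (fun ω => Real.negMulLog ((ρ[A.indicator (fun _ => (1 : ℝ)) | m]) ω)) ρ := by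
  refine Integrable.of_bound (aestronglyMeasurable_negMulLog_condExp ρ hm _) 1 ?_
  filter_upwards [condExp_indicator_mem_Icc ρ hm hA] with ω hω
  have := negMulLog_mem_Icc hω
  rw [Real.norm_eq_abs, abs_of_nonneg this.1]
  exact this.2

variable {I J : Type*} [Fintype I] [MeasurableSpace I] [MeasurableSingletonClass I]
  [Fintype J] [MeasurableSpace J] [MeasurableSingletonClass J]

lemma condEntropy_nonneg (ρ : Measure Ω) [IsProbabilityMeasure ρ] {p : Ω → I}
    (hp : Measurable p) (hm : m ≤ mΩ) : 0 ≤ condEntropy ρ p m := by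
  refine Finset.sum_nonneg fun i _ => integral_nonneg_of_ae ?_
  filter_upwards [condExp_indicator_mem_Icc ρ hm (hp (measurableSet_singleton i))] with ω hω
  exact (negMulLog_mem_Icc hω).1

lemma condEntropy_le_card (ρ : Measure Ω) [IsProbabilityMeasure ρ] {p : Ω → I}
    (hp : Measurable p) (hm : m ≤ mΩ) :
    condEntropy ρ p m ≤ Fintype.card I := by
  have : ∀ i ∈ (Finset.univ : Finset I),
      ∫ ω, Real.negMulLog ((ρ[(p ⁻¹' {i}).indicator (fun _ => (1 : ℝ)) | m]) ω) ∂ρ ≤ 1 := by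
    intro i _
    have hi := hp (measurableSet_singleton i)
    calc _ ≤ ∫ _, (1 : ℝ) ∂ρ := by
          refine integral_mono_ae (integrable_negMulLog_condExp ρ hm hi) (integrable_const 1) ?_
          filter_upwards [condExp_indicator_mem_Icc ρ hm hi] with ω hω
          exact (negMulLog_mem_Icc hω).2
      _ = 1 := by simp
  simpa [condEntropy] using Finset.sum_le_sum this

lemma condEntropy_anti (ρ : Measure Ω) [IsProbabilityMeasure ρ] {p : Ω → I}
    (hp : Measurable p) (h12 : m₁ ≤ m₂) (h2 : m₂ ≤ mΩ) :
    condEntropy ρ p m₂ ≤ condEntropy ρ p m₁ := by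
  refine Finset.sum_le_sum fun i _ => ?_
  have hi := hp (measurableSet_singleton i)
  set f : Ω → ℝ := (p ⁻¹' {i}).indicator fun _ => 1 with hf
  have h1 : m₁ ≤ mΩ := h12.trans h2
  have hJ : ρ[Real.negMulLog ∘ ρ[f | m₂] | m₁] ≤ᵐ[ρ] Real.negMulLog ∘ ρ[ρ[f | m₂] | m₁] :=
    Real.concaveOn_negMulLog.condExp_map_le h1
      (Real.continuous_negMulLog.upperSemicontinuous.upperSemicontinuousOn _)
      (by filter_upwards [condExp_indicator_mem_Icc ρ h2 hi] with ω hω using hω.1)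
      isClosed_Ici integrable_condExp (integrable_negMulLog_condExp ρ h2 hi)
  have htower : ρ[ρ[f | m₂] | m₁] =ᵐ[ρ] ρ[f | m₁] := condExp_condExp_of_le h12 h2
  calc ∫ ω, Real.negMulLog ((ρ[f | m₂]) ω) ∂ρ
      = ∫ ω, (ρ[Real.negMulLog ∘ ρ[f | m₂] | m₁]) ω ∂ρ := (integral_condExp h1).symm
    _ ≤ ∫ ω, Real.negMulLog ((ρ[f | m₁]) ω) ∂ρ := by
      refine integral_mono_ae integrable_condExp (integrable_negMulLog_condExp ρ h1 hi) ?_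
      filter_upwards [hJ, htower] with ω hω ht
      simpa [ht] using hω

lemma tendsto_condEntropy_iSup (ρ : Measure Ω) [IsProbabilityMeasure ρ] {p : Ω → I}
    (hp : Measurable p) {m : ℕ → MeasurableSpace Ω} (hmono : Monotone m) (hm : ∀ n, m n ≤ mΩ) :
    Tendsto (fun n => condEntropy ρ p (m n)) atTop (𝓝 (condEntropy ρ p (⨆ n, m n))) := by
  refine tendsto_finsetSum _ fun i _ => ?_
  have hi := hp (measurableSet_singleton i)
  refine tendsto_integral_of_dominated_convergence (fun _ => 1)
    (fun n => aestronglyMeasurable_negMulLog_condExp ρ (hm n) _) (integrable_const 1)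
    (fun n => ?_) ?_
  · filter_upwards [condExp_indicator_mem_Icc ρ (hm n) hi] with ω hω
    have := negMulLog_mem_Icc hω
    rw [Real.norm_eq_abs, abs_of_nonneg this.1]
    exact this.2
  · filter_upwards [tendsto_ae_condExp (μ := ρ) (ℱ := ⟨m, hmono, hm⟩)
      ((p ⁻¹' {i}).indicator fun _ => (1 : ℝ))] with ω hω
    exact (Real.continuous_negMulLog.tendsto _).comp hω

lemma condEntropy_eq_zero (ρ : Measure Ω) [IsProbabilityMeasure ρ] {p : Ω → I}
    (hp : Measurable p) : condEntropy ρ p mΩ = 0 := by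
  refine Finset.sum_eq_zero fun i _ => ?_
  have hi := hp (measurableSet_singleton i)
  rw [condExp_of_stronglyMeasurable le_rfl
    (stronglyMeasurable_const.indicator hi) ((integrable_const 1).indicator hi)]
  refine integral_eq_zero_of_ae (ae_of_all _ fun ω => ?_)
  by_cases h : ω ∈ p ⁻¹' {i} <;> simp [h]

/-- The chain rule for the entropy of finite partitions. -/
lemma partEntropy_prodMk (ρ : Measure Ω) [IsProbabilityMeasure ρ] {p : Ω → I} {q : Ω → J}
    (hp : Measurable p) (hq : Measurable q) :
    partEntropy ρ (fun ω => (p ω, q ω)) =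
      partEntropy ρ q + condEntropy ρ p (MeasurableSpace.comap q inferInstance) := by
  have hle : MeasurableSpace.comap q inferInstance ≤ mΩ := hq.comap_le
  have hfac : ∀ i, ∃ g : J → ℝ,
      ρ[(p ⁻¹' {i}).indicator (fun _ => (1 : ℝ)) | MeasurableSpace.comap q inferInstance]
        = g ∘ q := fun i => by
    obtain ⟨g, -, hg⟩ := (stronglyMeasurable_condExp (μ := ρ)
      (f := (p ⁻¹' {i}).indicator fun _ => (1 : ℝ))
      (m := MeasurableSpace.comap q inferInstance)).measurable.exists_eq_measurable_comp
    exact ⟨g, hg⟩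
  choose g hg using hfac
  have hcell : ∀ i j, ρ.real ((fun ω => (p ω, q ω)) ⁻¹' {(i, j)})
      = ρ.real (q ⁻¹' {j}) * g i j := by
    intro i j
    have hi := hp (measurableSet_singleton i)
    have hj := hq (measurableSet_singleton j)
    have h1 := setIntegral_condExp (μ := ρ) hle
      (f := (p ⁻¹' {i}).indicator fun _ => (1 : ℝ))
      ((integrable_const 1).indicator hi) (s := q ⁻¹' {j})
      ⟨{j}, measurableSet_singleton j, rfl⟩
    rw [hg i, setIntegral_congr_fun (g := fun _ => g i j) hj
      (fun ω hω => by
        have : q ω = j := hω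
        simp [this]), integral_indicator hi, Measure.restrict_restrict hi] at h1
    simp only [integral_const, smul_eq_mul, mul_one, measureReal_restrict_apply_univ] at h1
    rw [h1]
    congr 1
    ext ω
    simp
  have hmarg : ∀ j, ∑ i, ρ.real (q ⁻¹' {j}) * g i j = ρ.real (q ⁻¹' {j}) := by
    intro j
    simp_rw [← hcell]
    rw [← measureReal_biUnion_finset]
    · congr 1
      ext ω
      simp
    · intro a _ b _ hab
      refine Set.disjoint_left.2 fun ω h1 h2 => hab ?_
      have h1' : p ω = a := (Prod.ext_iff.1 h1).1
      have h2' : p ω = b := (Prod.ext_iff.1 h2).1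
      exact h1'.symm.trans h2'
    · intro i _
      exact (hp.prodMk hq) (measurableSet_singleton _)
  have hcond : condEntropy ρ p (MeasurableSpace.comap q inferInstance)
      = ∑ j, ∑ i, ρ.real (q ⁻¹' {j}) * Real.negMulLog (g i j) := by
    rw [Finset.sum_comm]
    refine Finset.sum_congr rfl fun i _ => ?_
    rw [hg i]
    have : (fun ω => Real.negMulLog ((g i ∘ q) ω)) = fun ω => (Real.negMulLog ∘ g i) (q ω) := rfl
    have hmeas : Measurable (Real.negMulLog ∘ g i) := measurable_of_finite _
    rw [this, ← integral_map hq.aemeasurable hmeas.aestronglyMeasurable,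
      integral_fintype (Integrable.of_finite)]
    refine Finset.sum_congr rfl fun j _ => ?_
    rw [map_measureReal_apply hq (measurableSet_singleton j)]
    simp
  rw [hcond, partEntropy, partEntropy, Fintype.sum_prod_type_right, ← Finset.sum_add_distrib]
  refine Finset.sum_congr rfl fun j _ => ?_
  change ∑ i, Real.negMulLog (ρ.real _) = Real.negMulLog (ρ.real _) + _
  simp_rw [hcell, Real.negMulLog_mul]
  rw [Finset.sum_add_distrib, ← Finset.sum_mul]
  congr 1
  by_cases h0 : ρ.real (q ⁻¹' {j}) = 0
  · simp [h0]
  · have := hmarg j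
    rw [← Finset.mul_sum] at this
    rw [mul_right_eq_self₀.1 this |>.resolve_right h0, one_mul]

lemma partEntropy_nonneg (ρ : Measure Ω) [IsProbabilityMeasure ρ] {K : Type*} [Fintype K]
    (p : Ω → K) : 0 ≤ partEntropy ρ p :=
  Finset.sum_nonneg fun _ _ => Real.negMulLog_nonneg measureReal_nonneg measureReal_le_one

lemma partEntropy_equiv_comp (ρ : Measure Ω) {K L : Type*} [Fintype K] [Fintype L] (e : K ≃ L)
    (p : Ω → K) : partEntropy ρ (e ∘ p) = partEntropy ρ p := by
  refine (Fintype.sum_equiv e _ _ fun k => ?_).symm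
  congr 3
  ext ω
  simp

lemma partEntropy_map {Z : Type*} [MeasurableSpace Z] (ρ : Measure Ω) {f : Ω → Z}
    (hf : Measurable f) {p : Z → I} (hp : Measurable p) :
    partEntropy (ρ.map f) p = partEntropy ρ (p ∘ f) := by
  refine Finset.sum_congr rfl fun i _ => ?_
  rw [Measure.map_apply hf (hp (measurableSet_singleton i)), preimage_comp]

lemma partEntropy_unique (ρ : Measure Ω) [IsProbabilityMeasure ρ] {K : Type*} [Fintype K]
    [Unique K] (p : Ω → K) : partEntropy ρ p = 0 := by
  have : p ⁻¹' {default} = univ := by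
    ext ω
    simp [eq_iff_true_of_subsingleton]
  simp [partEntropy, this]

lemma condExp_indicator_comap_ae_eq {Z : Type*} [mZ : MeasurableSpace Z] (ρ : Measure Ω)
    [IsProbabilityMeasure ρ] {f : Ω → Z} (hf : Measurable f) {A : Set Ω} (hA : MeasurableSet A)
    {k : Z → ℝ≥0∞} (hk : Measurable k)
    (h : ∀ B, MeasurableSet B → ρ (A ∩ f ⁻¹' B) = ∫⁻ z in B, k z ∂(ρ.map f)) :
    ρ[A.indicator (fun _ => (1 : ℝ)) | MeasurableSpace.comap f mZ]
      =ᵐ[ρ] fun ω => (k (f ω)).toReal := by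
  have hfin : ∫⁻ ω, k (f ω) ∂ρ ≠ ∞ := by
    rw [← lintegral_map hk hf, ← setLIntegral_univ, ← h univ MeasurableSet.univ]
    exact measure_ne_top _ _
  have hint : Integrable (fun ω => (k (f ω)).toReal) ρ :=
    integrable_toReal_of_lintegral_ne_top (hk.comp hf).aemeasurable hfin
  symm
  refine ae_eq_condExp_of_forall_setIntegral_eq hf.comap_le ((integrable_const 1).indicator hA)
    (fun _ _ _ => hint.integrableOn) ?_ ?_
  · rintro _ ⟨B, hB, rfl⟩ -
    have hfB := hf hB
    have hkf : Measurable fun ω => k (f ω) := hk.comp hf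
    rw [integral_toReal hkf.aemeasurable
      (ae_lt_top hkf (ne_top_of_le_ne_top hfin (setLIntegral_le_lintegral _ _))),
      integral_indicator hA, Measure.restrict_restrict hA]
    simp only [integral_const, smul_eq_mul, mul_one, measureReal_restrict_apply_univ]
    rw [measureReal_def, h B hB, setLIntegral_map hB hk hf]
  · have : Measurable[MeasurableSpace.comap f mZ] fun ω => (k (f ω)).toReal :=
      hk.ennreal_toReal.comp (comap_measurable f)
    exact this.stronglyMeasurable.aestronglyMeasurable

lemma condEntropy_comap_eq {Z : Type*} [mZ : MeasurableSpace Z] (ρ : Measure Ω)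
    [IsProbabilityMeasure ρ] {f : Ω → Z} (hf : Measurable f) {p : Ω → I} (hp : Measurable p)
    {k : I → Z → ℝ≥0∞} (hk : ∀ i, Measurable (k i))
    (h : ∀ i B, MeasurableSet B →
      ρ (p ⁻¹' {i} ∩ f ⁻¹' B) = ∫⁻ z in B, k i z ∂(ρ.map f)) :
    condEntropy ρ p (MeasurableSpace.comap f mZ)
      = ∑ i, ∫ z, Real.negMulLog (k i z).toReal ∂(ρ.map f) := by
  refine Finset.sum_congr rfl fun i _ => ?_
  have hmeas : Measurable fun z => Real.negMulLog (k i z).toReal :=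
    Real.continuous_negMulLog.measurable.comp (hk i).ennreal_toReal
  rw [integral_map hf.aemeasurable hmeas.aestronglyMeasurable]
  refine integral_congr_ae ?_
  filter_upwards [condExp_indicator_comap_ae_eq ρ hf (hp (measurableSet_singleton i)) (hk i)
    (h i)] with ω hω
  rw [hω]

end ConditionalEntropy

section MarkovLaw

open ProbabilityTheory

variable [MeasurableSpace X] {Q : X → Measure X}

lemma measurable_map_of_isTransKernel (hQ : IsTransKernel Q) {Y Z : Type*} [MeasurableSpace Y]
    [MeasurableSpace Z] {e : Y → X} (he : Measurable e) {F : Y × X → Z} (hF : Measurable F) :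
    Measurable fun y => (Q (e y)).map fun x => F (y, x) := by
  let κ : Kernel X X := ⟨Q, hQ.1⟩
  have : IsMarkovKernel κ := ⟨hQ.2⟩
  refine Measure.measurable_of_measurable_coe _ fun s hs => ?_
  have h := Kernel.measurable_kernel_prodMk_left (κ := κ.comap e he) (hF hs)
  have heq : ∀ y, (Q (e y)).map (fun x => F (y, x)) s
      = κ.comap e he y (Prod.mk y ⁻¹' (F ⁻¹' s)) := fun y => by
    rw [Measure.map_apply (by fun_prop) hs]
    rfl
  simpa only [heq] using h

lemma measurable_lintegral_of_isTransKernel (hQ : IsTransKernel Q) {Y : Type*}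
    [MeasurableSpace Y] {e : Y → X} (he : Measurable e) {F : Y × X → ℝ≥0∞} (hF : Measurable F) :
    Measurable fun y => ∫⁻ x, F (y, x) ∂(Q (e y)) := by
  let κ : Kernel X X := ⟨Q, hQ.1⟩
  have : IsMarkovKernel κ := ⟨hQ.2⟩
  exact Measurable.lintegral_kernel_prod_right' (κ := κ.comap e he) hF

lemma measurable_fin_snoc (n : ℕ) :
    Measurable fun z : (Fin (n + 1) → X) × X => (Fin.snoc z.1 z.2 : Fin (n + 2) → X) := by
  refine measurable_pi_lambda _ fun i => ?_
  refine Fin.lastCases ?_ (fun j => ?_) i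
  · simpa using measurable_snd
  · simp only [Fin.snoc_castSucc]
    fun_prop

lemma lintegral_markovLaw_succ (hQ : IsTransKernel Q) (μ : Measure X) (n : ℕ)
    {f : (Fin (n + 2) → X) → ℝ≥0∞} (hf : Measurable f) :
    ∫⁻ x, f x ∂(markovLaw μ Q (n + 1)) =
      ∫⁻ x, ∫⁻ y, f (Fin.snoc x y) ∂(Q (x (Fin.last n))) ∂(markovLaw μ Q n) := by
  have hs := measurable_fin_snoc (X := X) n
  rw [markovLaw, Measure.lintegral_bind
    (measurable_map_of_isTransKernel hQ (measurable_pi_apply _) hs).aemeasurable hf.aemeasurable]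
  refine lintegral_congr fun x => ?_
  rw [lintegral_map hf (by fun_prop)]

lemma lintegral_markovLaw_zero (μ : Measure X) {f : (Fin 1 → X) → ℝ≥0∞} (hf : Measurable f) :
    ∫⁻ x, f x ∂(markovLaw μ Q 0) = ∫⁻ x, f (fun _ => x) ∂μ := by
  rw [markovLaw, lintegral_map hf (by fun_prop)]

lemma lintegral_markovLaw_withDensity (hQ : IsTransKernel Q) (μ : Measure X) {k : X → ℝ≥0∞}
    (hk : Measurable k) (n : ℕ) {f : (Fin (n + 1) → X) → ℝ≥0∞} (hf : Measurable f) :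
    ∫⁻ x, f x ∂(markovLaw (μ.withDensity k) Q n) = ∫⁻ x, k (x 0) * f x ∂(markovLaw μ Q n) := by
  induction n with
  | zero =>
    rw [lintegral_markovLaw_zero _ hf,
      lintegral_markovLaw_zero _ (f := fun x => k (x 0) * f x) (by fun_prop),
      lintegral_withDensity_eq_lintegral_mul _ hk (by fun_prop)]
    rfl
  | succ n ih =>
    have hs := measurable_fin_snoc (X := X) n
    have hF : Measurable fun x : Fin (n + 1) → X => ∫⁻ y, f (Fin.snoc x y) ∂(Q (x (Fin.last n))) :=
      measurable_lintegral_of_isTransKernel hQ (F := fun z => f (Fin.snoc z.1 z.2))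
        (measurable_pi_apply (Fin.last n)) (hf.comp hs)
    rw [lintegral_markovLaw_succ hQ _ _ hf,
      lintegral_markovLaw_succ hQ _ _ (f := fun x => k (x 0) * f x) (by fun_prop), ih hF]
    refine lintegral_congr fun x => ?_
    have h0 : ∀ y : X, (Fin.snoc x y : Fin (n + 2) → X) 0 = x 0 := fun y =>
      Fin.snoc_castSucc (α := fun _ : Fin (n + 2) => X) (x := y) (p := x) (i := 0)
    simp_rw [h0]
    rw [lintegral_const_mul _ (by fun_prop)]

lemma measurable_fin_tail (n : ℕ) :
    Measurable (Fin.tail : (Fin (n + 2) → X) → Fin (n + 1) → X) :=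
  measurable_pi_lambda _ fun i => measurable_pi_apply i.succ

lemma lintegral_markovLaw_tail (hQ : IsTransKernel Q) (μ : Measure X) (n : ℕ)
    {f : (Fin (n + 1) → X) → ℝ≥0∞} (hf : Measurable f) :
    ∫⁻ x, f (Fin.tail x) ∂(markovLaw μ Q (n + 1)) = ∫⁻ x, f x ∂(markovLaw (μ.bind Q) Q n) := by
  induction n with
  | zero =>
    have hs := measurable_fin_snoc (X := X) 0
    have hft : Measurable fun x : Fin 2 → X => f (Fin.tail x) := hf.comp (measurable_fin_tail 0)
    rw [lintegral_markovLaw_succ hQ _ _ hft, lintegral_markovLaw_zero,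
      lintegral_markovLaw_zero _ hf,
      Measure.lintegral_bind hQ.1.aemeasurable (Measurable.aemeasurable (by fun_prop))]
    · refine lintegral_congr fun x => lintegral_congr fun y => ?_
      congr 1
    · exact measurable_lintegral_of_isTransKernel hQ (measurable_pi_apply (Fin.last 0))
        (hft.comp hs)
  | succ n ih =>
    have hs := measurable_fin_snoc (X := X) n
    have hF : Measurable fun x : Fin (n + 1) → X => ∫⁻ y, f (Fin.snoc x y) ∂(Q (x (Fin.last n))) :=
      measurable_lintegral_of_isTransKernel hQ (F := fun z => f (Fin.snoc z.1 z.2))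
        (measurable_pi_apply (Fin.last n)) (hf.comp hs)
    rw [lintegral_markovLaw_succ hQ _ _ (f := fun x => f (Fin.tail x))
        (hf.comp (measurable_fin_tail (n + 1))),
      lintegral_markovLaw_succ hQ _ _ hf, ← ih hF]
    refine lintegral_congr fun x => lintegral_congr fun y => ?_
    congr 1
    ext i
    refine Fin.lastCases ?_ (fun j => ?_) i
    · simp only [Fin.tail, Fin.succ_last, Fin.snoc_last]
    · simp only [Fin.tail, Fin.succ_castSucc, Fin.snoc_castSucc]

lemma isProbabilityMeasure_markovLaw (hQ : IsTransKernel Q) (μ : Measure X)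
    [IsProbabilityMeasure μ] (n : ℕ) : IsProbabilityMeasure (markovLaw μ Q n) := by
  refine ⟨?_⟩
  rw [← lintegral_one]
  induction n with
  | zero => simp [lintegral_markovLaw_zero μ measurable_const]
  | succ n ih =>
    have := hQ.2
    rw [lintegral_markovLaw_succ hQ _ _ measurable_const]
    simpa using ih

lemma lintegral_markovLaw_eval_zero (hQ : IsTransKernel Q) (μ : Measure X) (n : ℕ)
    {f : X → ℝ≥0∞} (hf : Measurable f) :
    ∫⁻ x, f (x 0) ∂(markovLaw μ Q n) = ∫⁻ x, f x ∂μ := by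
  induction n with
  | zero => rw [lintegral_markovLaw_zero μ (f := fun x => f (x 0)) (by fun_prop)]
  | succ n ih =>
    have := hQ.2
    rw [lintegral_markovLaw_succ hQ _ _ (f := fun x => f (x 0)) (by fun_prop), ← ih]
    refine lintegral_congr fun x => ?_
    have h0 : ∀ y : X, (Fin.snoc x y : Fin (n + 2) → X) 0 = x 0 := fun y =>
      Fin.snoc_castSucc (α := fun _ : Fin (n + 2) => X) (x := y) (p := x) (i := 0)
    simp [h0]

lemma map_tail_markovLaw (hQ : IsTransKernel Q) {μ : Measure X} (hμ : μ.bind Q = μ) (n : ℕ) :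
    (markovLaw μ Q (n + 1)).map Fin.tail = markovLaw μ Q n := by
  ext s hs
  have h := lintegral_markovLaw_tail hQ μ n (measurable_one.indicator hs)
  rw [hμ, ← lintegral_map (measurable_one.indicator hs) (measurable_fin_tail n)] at h
  simpa [lintegral_indicator_one hs] using h

lemma map_eval_zero_markovLaw (hQ : IsTransKernel Q) (μ : Measure X) (n : ℕ) :
    (markovLaw μ Q n).map (fun x => x 0) = μ := by
  ext s hs
  have h := lintegral_markovLaw_eval_zero hQ μ n (measurable_one.indicator hs)
  rw [← lintegral_map (measurable_one.indicator hs) (measurable_pi_apply 0)] at h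
  simpa [lintegral_indicator_one hs] using h

lemma markovLaw_succ_inter_tail (hQ : IsTransKernel Q) (μ : Measure X) {A : Set X}
    (hA : MeasurableSet A) {k : X → ℝ≥0∞} (hk : Measurable k)
    (hkA : (μ.restrict A).bind Q = μ.withDensity k) (n : ℕ) {C : Set (Fin (n + 1) → X)}
    (hC : MeasurableSet C) :
    markovLaw μ Q (n + 1) ((fun x => x 0) ⁻¹' A ∩ Fin.tail ⁻¹' C)
      = ∫⁻ x in C, k (x 0) ∂(markovLaw μ Q n) := by
  have hA0 : MeasurableSet ((fun x : Fin (n + 2) → X => x 0) ⁻¹' A) := measurable_pi_apply 0 hA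
  have hCt := measurable_fin_tail n hC
  rw [← lintegral_indicator_one (hA0.inter hCt)]
  have h1 := lintegral_markovLaw_withDensity hQ μ (measurable_one.indicator hA) (n + 1)
    (measurable_one.indicator hCt)
  rw [withDensity_indicator_one hA] at h1
  have h2 := lintegral_markovLaw_tail hQ (μ.restrict A) n (measurable_one.indicator hC)
  have h3 := lintegral_markovLaw_withDensity hQ μ hk n (measurable_one.indicator hC)
  rw [hkA] at h2
  rw [← lintegral_indicator hC]
  calc _ = _ := lintegral_congr fun x => ?_
    _ = _ := h1.symm
    _ = _ := h2
    _ = _ := h3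
    _ = _ := lintegral_congr fun x => ?_
  · by_cases ha : x 0 ∈ A <;> by_cases hc : Fin.tail x ∈ C <;> simp [ha, hc]
  · by_cases hc : x ∈ C <;> simp [hc]

/-- The densities, with respect to an invariant `μ`, of the time-one law started in a cell. -/
lemma exists_density_bind_restrict (hQ : IsTransKernel Q) {μ : Measure X}
    [IsProbabilityMeasure μ] (hμ : μ.bind Q = μ) (A : Set X) :
    ∃ k : X → ℝ≥0∞, Measurable k ∧ (μ.restrict A).bind Q = μ.withDensity k := by
  have hle : (μ.restrict A).bind Q ≤ μ := by
    refine Measure.le_intro fun s hs _ => ?_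
    conv_rhs => rw [← hμ]
    rw [Measure.bind_apply hs hQ.1.aemeasurable, Measure.bind_apply hs hQ.1.aemeasurable]
    exact setLIntegral_le_lintegral _ _
  have : IsFiniteMeasure ((μ.restrict A).bind Q) := isFiniteMeasure_of_le μ hle
  exact ⟨_, Measure.measurable_rnDeriv _ _,
    (Measure.withDensity_rnDeriv_eq _ _ (Measure.absolutelyContinuous_of_le hle)).symm⟩

lemma partEntropy_markovLaw_succ (hQ : IsTransKernel Q) {μ : Measure X} [IsProbabilityMeasure μ]
    (hμ : μ.bind Q = μ) {l : ℕ} {p : X → Fin l} (hp : Measurable p) (n : ℕ) :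
    partEntropy (markovLaw μ Q (n + 1)) (fun x => p ∘ x) =
      partEntropy (markovLaw μ Q n) (fun x => p ∘ x) +
        condEntropy (markovLaw μ Q (n + 1)) (fun x => p (x 0))
          (MeasurableSpace.comap (fun x => p ∘ Fin.tail x) inferInstance) := by
  have := isProbabilityMeasure_markovLaw hQ μ (n + 1)
  have hpc : ∀ n : ℕ, Measurable fun x : Fin (n + 1) → X => p ∘ x := fun n =>
    measurable_pi_lambda _ fun i => hp.comp (measurable_pi_apply i)
  have h1 := partEntropy_map (markovLaw μ Q (n + 1)) (measurable_fin_tail n) (hpc n)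
  rw [map_tail_markovLaw hQ hμ] at h1
  have hp0 : Measurable fun x : Fin (n + 2) → X => p (x 0) := by fun_prop
  have hpt : Measurable fun x : Fin (n + 2) → X => p ∘ Fin.tail x :=
    (hpc n).comp (measurable_fin_tail n)
  rw [h1, Function.comp_def, ← partEntropy_prodMk _ hp0 hpt,
    ← partEntropy_equiv_comp _ (Fin.consEquiv fun _ : Fin (n + 2) => Fin l)]
  congr 1
  ext x i
  refine Fin.cases ?_ (fun j => ?_) i <;> simp [Fin.consEquiv, Fin.tail]

lemma sum_integral_density_le_condEntropy_markovLaw (hQ : IsTransKernel Q) {μ : Measure X}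
    [IsProbabilityMeasure μ] (hμ : μ.bind Q = μ) {l : ℕ} {p : X → Fin l} (hp : Measurable p)
    {k : Fin l → X → ℝ≥0∞} (hk : ∀ i, Measurable (k i))
    (hkp : ∀ i, (μ.restrict (p ⁻¹' {i})).bind Q = μ.withDensity (k i)) (n : ℕ) :
    ∑ i, ∫ x, Real.negMulLog (k i x).toReal ∂μ ≤
      condEntropy (markovLaw μ Q (n + 1)) (fun x => p (x 0))
        (MeasurableSpace.comap (fun x => p ∘ Fin.tail x) inferInstance) := by
  have := isProbabilityMeasure_markovLaw hQ μ (n + 1)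
  have ht := measurable_fin_tail (X := X) n
  have hp0 : Measurable fun x : Fin (n + 2) → X => p (x 0) := hp.comp (measurable_pi_apply 0)
  have heq := condEntropy_comap_eq (markovLaw μ Q (n + 1)) ht hp0
    (k := fun i z => k i (z 0)) (fun i => (hk i).comp (measurable_pi_apply 0)) (fun i B hB => by
      rw [map_tail_markovLaw hQ hμ]
      exact markovLaw_succ_inter_tail hQ μ (hp (measurableSet_singleton i)) (hk i) (hkp i) n hB)
  calc _ = condEntropy (markovLaw μ Q (n + 1)) (fun x => p (x 0))
        (MeasurableSpace.comap Fin.tail inferInstance) := by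
        rw [heq, map_tail_markovLaw hQ hμ]
        refine Finset.sum_congr rfl fun i _ => ?_
        have hmeas : Measurable fun x => Real.negMulLog (k i x).toReal :=
          Real.continuous_negMulLog.measurable.comp (hk i).ennreal_toReal
        conv_lhs => rw [← map_eval_zero_markovLaw hQ μ n]
        rw [integral_map (measurable_pi_apply 0).aemeasurable hmeas.aestronglyMeasurable]
    _ ≤ _ := by
        refine condEntropy_anti _ hp0 ?_ ht.comap_le
        have hpc : Measurable fun x : Fin (n + 1) → X => p ∘ x :=
          measurable_pi_lambda _ fun i => hp.comp (measurable_pi_apply i)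
        exact (hpc.comp (comap_measurable (Fin.tail : (Fin (n + 2) → X) → _))).comap_le

/-- The entropy of a Markov kernel dominates the one-step backward conditional entropy of every
finite partition. -/
lemma sum_integral_density_le_kernelEntropy (hQ : IsTransKernel Q) {μ : Measure X}
    [IsProbabilityMeasure μ] (hμ : μ.bind Q = μ) {l : ℕ} {p : X → Fin l} (hp : Measurable p)
    {k : Fin l → X → ℝ≥0∞} (hk : ∀ i, Measurable (k i))
    (hkp : ∀ i, (μ.restrict (p ⁻¹' {i})).bind Q = μ.withDensity (k i)) :
    ((∑ i, ∫ x, Real.negMulLog (k i x).toReal ∂μ : ℝ) : EReal) ≤ kernelEntropy μ Q := by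
  set h : ℝ := ∑ i, ∫ x, Real.negMulLog (k i x).toReal ∂μ with hh
  set a : ℕ → ℝ := fun n => partEntropy (markovLaw μ Q n) fun x => p ∘ x with ha
  have hprob := isProbabilityMeasure_markovLaw hQ μ
  have hstep := partEntropy_markovLaw_succ hQ hμ hp
  have hmeas : ∀ n : ℕ, Measurable fun x : Fin (n + 2) → X => p ∘ Fin.tail x := fun n =>
    measurable_pi_lambda _ fun i => hp.comp (measurable_pi_apply i.succ)
  have hlow : ∀ n : ℕ, n * h ≤ a n := by
    intro n
    induction n with
    | zero => simpa using partEntropy_nonneg _ _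
    | succ n ih =>
      have h1 := hstep n
      have h2 := sum_integral_density_le_condEntropy_markovLaw hQ hμ hp hk hkp n
      simp only [ha] at ih ⊢
      push_cast
      linarith
  have hupp : ∀ n : ℕ, a n ≤ n * l + a 0 := by
    intro n
    induction n with
    | zero => simp
    | succ n ih =>
      have h1 := hstep n
      have h2 := condEntropy_le_card (markovLaw μ Q (n + 1))
        (p := fun x => p (x 0)) (hp.comp (measurable_pi_apply 0)) (hmeas n).comap_le
      rw [Fintype.card_fin] at h2
      simp only [ha] at ih ⊢
      push_cast
      linarith
  have hlim : Tendsto (fun n : ℕ => h - (n : ℝ)⁻¹ * h) atTop (𝓝 h) := by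
    simpa using tendsto_const_nhds.sub (tendsto_inv_atTop_nhds_zero_nat.mul_const h)
  have hle : h ≤ limsup (fun n : ℕ => (n : ℝ)⁻¹ * a (n - 1)) atTop := by
    rw [← hlim.limsup_eq]
    refine limsup_le_limsup ?_ hlim.isCoboundedUnder_le ?_
    · filter_upwards [eventually_ge_atTop 1] with n hn
      obtain ⟨n, rfl⟩ := Nat.exists_eq_add_of_le' hn
      have hpos : (0 : ℝ) < ((n + 1 : ℕ) : ℝ) := by positivity
      calc h - ((n + 1 : ℕ) : ℝ)⁻¹ * h = ((n + 1 : ℕ) : ℝ)⁻¹ * (n * h) := by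
            field_simp
            push_cast
            ring
        _ ≤ _ := by
            gcongr
            exact hlow n
    · refine isBoundedUnder_of_eventually_le (a := (l : ℝ) + a 0) ?_
      filter_upwards [eventually_ge_atTop 1] with n hn
      obtain ⟨n, rfl⟩ := Nat.exists_eq_add_of_le' hn
      have hpos : (0 : ℝ) < ((n + 1 : ℕ) : ℝ) := by positivity
      rw [inv_mul_le_iff₀ hpos]
      have h0 : 0 ≤ a 0 := partEntropy_nonneg _ _
      have := hupp n
      push_cast
      have hl : (0 : ℝ) ≤ l := Nat.cast_nonneg l
      nlinarith [mul_nonneg (Nat.cast_nonneg (α := ℝ) n) h0]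
  refine le_trans (EReal.coe_le_coe_iff.2 hle) ?_
  exact le_iSup_of_le l (le_iSup_of_le p (le_iSup_of_le hp le_rfl))

end MarkovLaw

section Generator

variable {Y : Type*} [mY : MeasurableSpace Y]

lemma partEntropy_le_prodMk (ρ : Measure Y) [IsProbabilityMeasure ρ] {I J : Type*} [Fintype I]
    [MeasurableSpace I] [MeasurableSingletonClass I] [Fintype J] [MeasurableSpace J]
    [MeasurableSingletonClass J] {p : Y → I} {q : Y → J} (hp : Measurable p) (hq : Measurable q) :
    partEntropy ρ q ≤ partEntropy ρ fun y => (q y, p y) := by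
  rw [← partEntropy_equiv_comp ρ (Equiv.prodComm J I)]
  have h := partEntropy_prodMk ρ hp hq
  have h0 := condEntropy_nonneg ρ hp hq.comap_le
  simp only [Function.comp_def, Equiv.prodComm_apply, Prod.swap_prod_mk]
  linarith

lemma partEntropy_itinerary_succ {ν : Measure Y} [IsProbabilityMeasure ν] {g : Y → Y}
    (hg : Measurable g) (hinv : ν.map g = ν) {m l : ℕ} {R : Y → Fin m} {P : Y → Fin l}
    (hR : Measurable R) (hP : Measurable P) (n : ℕ) :
    partEntropy ν (fun y (i : Fin (n + 1)) => (R (g^[i.val] y), P (g^[i.val] y))) =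
      partEntropy ν (fun y (i : Fin n) => (R (g^[i.val] y), P (g^[i.val] y))) +
        (condEntropy ν P (MeasurableSpace.comap
            (fun y (i : Fin n) => (R (g^[i.val + 1] y), P (g^[i.val + 1] y))) inferInstance) +
          condEntropy ν R (MeasurableSpace.comap (fun y => (P y, fun i : Fin n =>
            (R (g^[i.val + 1] y), P (g^[i.val + 1] y)))) inferInstance)) := by
  have hgi : ∀ i, Measurable g^[i] := fun i => hg.iterate i
  have hV : Measurable fun y (i : Fin n) => (R (g^[i.val + 1] y), P (g^[i.val + 1] y)) :=
    measurable_pi_lambda _ fun i => (hR.comp (hgi _)).prodMk (hP.comp (hgi _))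
  have hW : Measurable fun y (i : Fin n) => (R (g^[i.val] y), P (g^[i.val] y)) :=
    measurable_pi_lambda _ fun i => (hR.comp (hgi _)).prodMk (hP.comp (hgi _))
  have h1 := partEntropy_map ν hg hW
  rw [hinv] at h1
  rw [h1, ← add_assoc]
  simp only [Function.comp_def, ← Function.iterate_succ_apply, Nat.succ_eq_add_one]
  rw [← partEntropy_prodMk ν hP hV, ← partEntropy_prodMk ν hR (hP.prodMk hV),
    ← partEntropy_equiv_comp ν ((Equiv.prodAssoc (Fin m) (Fin l) _).symm.trans
      (Fin.consEquiv fun _ : Fin (n + 1) => Fin m × Fin l))]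
  congr 1
  ext y i : 2
  refine Fin.cases ?_ (fun j => ?_) i <;> simp [Fin.consEquiv]

/-- The entropy of a measure-preserving map with a one-sided generator `P` is at most the
entropy of `P` conditioned on its strict future. -/
lemma ksEntropy_le_condEntropy_of_generator {ν : Measure Y} [IsProbabilityMeasure ν] {g : Y → Y}
    (hg : Measurable g) (hinv : ν.map g = ν) {l : ℕ} {P : Y → Fin l} (hP : Measurable P)
    (hgen : mY ≤ MeasurableSpace.comap (fun y (i : ℕ) => P (g^[i] y)) inferInstance) :
    ksEntropy ν g ≤ ((condEntropy ν P (MeasurableSpace.comap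
      (fun y (i : ℕ) => P (g^[i + 1] y)) inferInstance) : ℝ) : EReal) := by
  have hgi : ∀ i, Measurable g^[i] := fun i => hg.iterate i
  refine iSup_le fun m => iSup_le fun R => iSup_le fun hR => EReal.coe_le_coe_iff.2 ?_
  set V : (n : ℕ) → Y → Fin n → Fin m × Fin l :=
    fun n y i => (R (g^[i.val + 1] y), P (g^[i.val + 1] y)) with hVdef
  have hV : ∀ n, Measurable (V n) := fun n =>
    measurable_pi_lambda _ fun i => (hR.comp (hgi _)).prodMk (hP.comp (hgi _))
  set mV : ℕ → MeasurableSpace Y := fun n => MeasurableSpace.comap (V n) inferInstance with hmV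
  set mPV : ℕ → MeasurableSpace Y :=
    fun n => MeasurableSpace.comap (fun y => (P y, V n y)) inferInstance with hmPV
  have hmVle : ∀ n, mV n ≤ mY := fun n => (hV n).comap_le
  have hmPVle : ∀ n, mPV n ≤ mY := fun n => (hP.prodMk (hV n)).comap_le
  have hmVmono : Monotone mV := monotone_nat_of_le_succ fun n => by
    have : Measurable[mV (n + 1)] (V (n + 1)) := comap_measurable _
    refine Measurable.comap_le (m₁ := mV (n + 1)) ?_
    exact @measurable_pi_lambda _ _ _ (mV (n + 1)) _ _ fun i =>
      (measurable_pi_apply i.castSucc).comp this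
  have hmPVmono : Monotone mPV := monotone_nat_of_le_succ fun n => by
    have : Measurable[mPV (n + 1)] fun y => (P y, V (n + 1) y) := comap_measurable _
    refine Measurable.comap_le (m₁ := mPV (n + 1)) (Measurable.prodMk this.fst ?_)
    exact @measurable_pi_lambda _ _ _ (mPV (n + 1)) _ _ fun i =>
      (measurable_pi_apply i.castSucc).comp this.snd
  have hsupPV : ⨆ n, mPV n = mY := by
    refine le_antisymm (iSup_le hmPVle) (hgen.trans ?_)
    refine Measurable.comap_le (m₁ := ⨆ n, mPV n)
      (@measurable_pi_lambda _ _ _ (⨆ n, mPV n) _ _ fun i => ?_)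
    cases i with
    | zero =>
      have : Measurable[mPV 0] fun y => (P y, V 0 y) := comap_measurable _
      exact Measurable.mono this.fst (le_iSup mPV 0) le_rfl
    | succ i =>
      have : Measurable[mPV (i + 1)] fun y => (P y, V (i + 1) y) := comap_measurable _
      exact Measurable.mono ((measurable_pi_apply (Fin.last i)).comp this.snd).snd
        (le_iSup mPV (i + 1)) le_rfl
  have hfut : MeasurableSpace.comap (fun y (i : ℕ) => P (g^[i + 1] y)) inferInstance
      ≤ ⨆ n, mV n := by
    refine Measurable.comap_le (m₁ := ⨆ n, mV n)
      (@measurable_pi_lambda _ _ _ (⨆ n, mV n) _ _ fun i => ?_)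
    have : Measurable[mV (i + 1)] (V (i + 1)) := comap_measurable _
    exact Measurable.mono ((measurable_pi_apply (Fin.last i)).comp this).snd
      (le_iSup mV (i + 1)) le_rfl
  have hlim := (tendsto_condEntropy_iSup ν hP hmVmono hmVle).add
    (tendsto_condEntropy_iSup ν hR hmPVmono hmPVle)
  rw [hsupPV, condEntropy_eq_zero ν hR, add_zero] at hlim
  set s : ℕ → ℝ := fun n =>
    partEntropy ν (fun y (i : Fin n) => (R (g^[i.val] y), P (g^[i.val] y))) with hs
  have hsum : ∀ n, s n =
      ∑ i ∈ Finset.range n, (condEntropy ν P (mV i) + condEntropy ν R (mPV i)) := by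
    intro n
    induction n with
    | zero => simpa using partEntropy_unique ν _
    | succ n ih =>
      rw [Finset.sum_range_succ, ← ih]
      exact partEntropy_itinerary_succ hg hinv hR hP n
  have hces := hlim.cesaro
  simp only [← hsum] at hces
  have hle : ∀ n, partEntropy ν (fun y (i : Fin n) => R (g^[i.val] y)) ≤ s n := by
    intro n
    have h := partEntropy_le_prodMk ν
      (p := fun y (i : Fin n) => P (g^[i.val] y)) (q := fun y (i : Fin n) => R (g^[i.val] y))
      (measurable_pi_lambda _ fun i => hP.comp (hgi _))
      (measurable_pi_lambda _ fun i => hR.comp (hgi _))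
    rw [← partEntropy_equiv_comp ν (Equiv.arrowProdEquivProdArrow (Fin n) (fun _ => Fin m)
      (fun _ => Fin l)).symm] at h
    exact h
  calc _ ≤ limsup (fun n : ℕ => (n : ℝ)⁻¹ * s n) atTop := by
        refine limsup_le_limsup (Eventually.of_forall fun n => ?_) ?_ hces.isBoundedUnder_le
        · exact mul_le_mul_of_nonneg_left (hle n) (by positivity)
        · exact (isBoundedUnder_of_eventually_ge (a := (0 : ℝ)) (Eventually.of_forall fun n =>
            mul_nonneg (by positivity) (partEntropy_nonneg ν _))).isCoboundedUnder_le
    _ = condEntropy ν P (⨆ n, mV n) := hces.limsup_eq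
    _ ≤ _ := condEntropy_anti ν hP hfut (iSup_le hmVle)

end Generator

section OrbitSpace

lemma exists_measurable_fin_fiber_dist_le [MetricSpace X] [CompactSpace X] [MeasurableSpace X]
    [BorelSpace X] {ε : ℝ} (hε : 0 < ε) :
    ∃ (l : ℕ) (p : X → Fin l), Measurable p ∧ ∀ x y, p x = p y → dist x y ≤ ε := by
  obtain ⟨t, -, htf, ht⟩ := Metric.finite_approx_of_totallyBounded
    (isCompact_univ (X := X)).totallyBounded (ε / 2) (half_pos hε)
  have := htf.fintype
  let q : X → t → Bool := fun x i => decide (dist x i < ε / 2)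
  have hq : Measurable q := measurable_pi_lambda _ fun i =>
    measurable_to_bool (by
      have : (fun x => q x i) ⁻¹' {true} = Metric.ball (i : X) (ε / 2) := by
        ext x
        simp [q]
      rw [this]
      exact Metric.isOpen_ball.measurableSet)
  refine ⟨_, Fintype.equivFin (t → Bool) ∘ q, Measurable.of_discrete.comp hq, fun x y hxy => ?_⟩
  have hxy : q x = q y := (Fintype.equivFin _).injective hxy
  obtain ⟨i, hi, hxi⟩ := mem_iUnion₂.1 (ht (mem_univ x))
  have hyi : dist y i < ε / 2 := by
    have h := congrFun hxy ⟨i, hi⟩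
    simp only [q, decide_eq_decide] at h
    exact h.1 hxi
  have := dist_triangle_right x y i
  have hxi' : dist x i < ε / 2 := hxi
  linarith

lemma isClosed_orbitSpace [MetricSpace X] {T : X → Set X} (hT : IsCorrespondence T) :
    IsClosed (orbitSpace T) := by
  have : orbitSpace T = ⋂ k : ℕ, (fun x : ℕ → X => (x k, x (k + 1))) ⁻¹' {p | p.2 ∈ T p.1} := by
    ext x
    simp [orbitSpace]
  rw [this]
  exact isClosed_iInter fun k => hT.2.2.preimage (by fun_prop)

lemma measurable_shiftOrb [MeasurableSpace X] (T : X → Set X) : Measurable (shiftOrb T) := by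
  have : Measurable fun x : ↥(orbitSpace T) => shiftSeq x.1 :=
    measurable_pi_lambda _ fun k => (measurable_pi_apply (k + 1)).comp measurable_subtype_coe
  exact this.subtype_mk

lemma shiftOrb_iterate_apply (T : X → Set X) (n k : ℕ) (x : ↥(orbitSpace T)) :
    ((shiftOrb T)^[n] x).1 k = x.1 (k + n) := by
  induction n generalizing x with
  | zero => rfl
  | succ n ih =>
    rw [Function.iterate_succ_apply, ih]
    rfl

/-- Any partition finer than the expansive constant is a one-sided generator for the shift. -/
lemma le_comap_itinerary [MetricSpace X] [CompactSpace X] [MeasurableSpace X] [BorelSpace X]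
    {T : X → Set X} (hT : IsCorrespondence T) {ε : ℝ} (hexp : IsFwdExpansiveWith T ε) {l : ℕ}
    {p : X → Fin l} (hp : Measurable p) (hpε : ∀ x y, p x = p y → dist x y ≤ ε) :
    (inferInstance : MeasurableSpace ↥(orbitSpace T)) ≤ MeasurableSpace.comap
      (fun (y : ↥(orbitSpace T)) (i : ℕ) => p (((shiftOrb T)^[i] y).1 0)) inferInstance := by
  have : StandardBorelSpace ↥(orbitSpace T) := (isClosed_orbitSpace hT).measurableSet.standardBorel
  simp only [shiftOrb_iterate_apply, zero_add]
  have hmeas : Measurable fun (y : ↥(orbitSpace T)) (i : ℕ) => p (y.1 i) :=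
    measurable_pi_lambda _ fun i =>
      hp.comp ((measurable_pi_apply i).comp measurable_subtype_coe)
  refine (hmeas.measurableEmbedding fun x y hxy => ?_).comap_eq.ge
  by_contra hne
  obtain ⟨n, hn⟩ := hexp.2 x.1 x.2 y.1 y.2 fun h => hne (Subtype.ext h)
  exact hn.not_ge (hpε _ _ (congrFun hxy n))

lemma step2_prod [MeasurableSpace X] {μ : Measure X} {Q : X → Measure X} (hQ : IsTransKernel Q)
    {A B : Set X} (hA : MeasurableSet A) (hB : MeasurableSet B) :
    step2 μ Q (A ×ˢ B) = (μ.restrict A).bind Q B := by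
  have hm : Measurable fun x => (Q x).map fun y => (x, y) :=
    measurable_map_of_isTransKernel hQ measurable_id measurable_id
  rw [step2, Measure.bind_apply (hA.prod hB) hm.aemeasurable,
    Measure.bind_apply hB hQ.1.aemeasurable, ← lintegral_indicator hA]
  refine lintegral_congr fun x => ?_
  rw [Measure.map_apply measurable_prodMk_left (hA.prod hB)]
  by_cases hx : x ∈ A <;> simp [hx]

lemma condEntropy_orbitSpace_eq [MeasurableSpace X] {T : X → Set X}
    {ν : Measure ↥(orbitSpace T)} [IsProbabilityMeasure ν] {μ : Measure X} {Q : X → Measure X}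
    (hQ : IsTransKernel Q) (hμ : μ.bind Q = μ)
    (hproj : ν.map (fun x : ↥(orbitSpace T) => (x.1 0, x.1 1)) = step2 μ Q)
    {l : ℕ} {p : X → Fin l} (hp : Measurable p) {k : Fin l → X → ℝ≥0∞}
    (hk : ∀ i, Measurable (k i))
    (hkp : ∀ i, (μ.restrict (p ⁻¹' {i})).bind Q = μ.withDensity (k i)) :
    condEntropy ν (fun y => p (y.1 0)) (MeasurableSpace.comap (fun y => y.1 1) inferInstance)
      = ∑ i, ∫ x, Real.negMulLog (k i x).toReal ∂μ := by
  have he : ∀ j : ℕ, Measurable fun y : ↥(orbitSpace T) => y.1 j := fun j =>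
    (measurable_pi_apply j).comp measurable_subtype_coe
  have hrect : ∀ A B : Set X, MeasurableSet A → MeasurableSet B →
      ν ((fun y => y.1 0) ⁻¹' A ∩ (fun y => y.1 1) ⁻¹' B) = (μ.restrict A).bind Q B := by
    intro A B hA hB
    rw [← step2_prod hQ hA hB, ← hproj, Measure.map_apply ((he 0).prodMk (he 1)) (hA.prod hB)]
    rfl
  have hmap : ν.map (fun y => y.1 1) = μ := by
    ext B hB
    have h := hrect univ B MeasurableSet.univ hB
    rw [Measure.restrict_univ, hμ, preimage_univ, univ_inter] at h
    rw [Measure.map_apply (he 1) hB, h]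
  have h := condEntropy_comap_eq ν (he 1) (hp.comp (he 0)) hk fun i B hB => by
    rw [hmap, ← withDensity_apply _ hB, ← hkp i]
    exact hrect _ B (hp (measurableSet_singleton i)) hB
  rwa [hmap] at h

end OrbitSpace

/-- The Kolmogorov–Sinai entropy of a shift-invariant measure `ν` on the orbit space of a
forward expansive correspondence is dominated by the entropy of any Markov kernel `(μ,Q)`
supported by `T` whose two-step law is the two-coordinate projection of `ν`. -/
theorem shift_entropy_le_kernel_entropy
    {X : Type*} [MetricSpace X] [CompactSpace X] [MeasurableSpace X] [BorelSpace X]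
    (T : X → Set X) (hT : IsCorrespondence T) (hexp : IsFwdExpansive T)
    (ν : Measure ↥(orbitSpace T)) (hν : IsProbabilityMeasure ν)
    (hinv : ν.map (shiftOrb T) = ν)
    (Q : X → Measure X) (hQ : IsTransKernel Q) (hsupp : SupportedBy T Q)
    (μ : Measure X) (hμ : IsProbabilityMeasure μ) (hμinv : μ.bind Q = μ)
    (hproj : ν.map (fun x : ↥(orbitSpace T) => (x.1 0, x.1 1)) = step2 μ Q) :
    ksEntropy ν (shiftOrb T) ≤ kernelEntropy μ Q := by
  obtain ⟨ε, hε⟩ := hexp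
  obtain ⟨l, p, hp, hpε⟩ := exists_measurable_fin_fiber_dist_le (X := X) hε.1
  choose k hk hkp using fun i => exists_density_bind_restrict hQ hμinv (p ⁻¹' {i})
  have he : ∀ j : ℕ, Measurable fun y : ↥(orbitSpace T) => y.1 j := fun j =>
    (measurable_pi_apply j).comp measurable_subtype_coe
  have hshift := measurable_shiftOrb T
  refine (ksEntropy_le_condEntropy_of_generator hshift hinv
    (P := fun y => p (y.1 0)) (hp.comp (he 0)) (le_comap_itinerary hT hε hp hpε)).trans ?_
  refine le_trans (EReal.coe_le_coe_iff.2 ?_)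
    (sum_integral_density_le_kernelEntropy hQ hμinv hp hk hkp)
  rw [← condEntropy_orbitSpace_eq hQ hμinv hproj hp hk hkp]
  have hfut : Measurable fun (y : ↥(orbitSpace T)) (i : ℕ) =>
      p (((shiftOrb T)^[i + 1] y).1 0) :=
    measurable_pi_lambda _ fun i => (hp.comp (he 0)).comp (hshift.iterate (i + 1))
  refine condEntropy_anti ν (hp.comp (he 0)) ?_ hfut.comap_le
  have hgen := MeasurableSpace.comap_mono (g := shiftOrb T) ((he 0).comap_le.trans
    (le_comap_itinerary hT hε hp hpε))
  rw [MeasurableSpace.comap_comp, MeasurableSpace.comap_comp] at hgen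
  exact hgen

end Corr
end

section
/- Pressure is unchanged by restriction to a closed subset of full invariant measure: Let T be a correspondence on a compact metric space (X,d), Y ⊆ X a non-empty closed set such that T|_Y (defined by T|_Y(x) := T(x) ∩ Y for x ∈ Y) is a correspondence on Y, and φ : O₂(T) → ℝ a continuous function. Assume that μ(Y) = 1 for every Borel probability measure μ on X with the property that μ is Q-invariant for some transition probability kernel Q on X supported by T. Then P(T,φ) = P(T|_Y, φ|_{O₂(T|_Y)}). -/
open Filter MeasureTheory Set
open scoped Topology ENNReal Classical

namespace Corr

/-- The minimizers of `g` on the values of the set-valued map `S`. -/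
def argminMap {α Z : Type*} (S : α → Set Z) (g : Z → ℝ) (x : α) : Set Z :=
  {y | y ∈ S x ∧ ∀ z ∈ S x, g y ≤ g z}

/-- `S` is a weakly measurable set-valued map with nonempty closed values. -/
structure IsMeasurableClosedMap {α Z : Type*} [MeasurableSpace α] [TopologicalSpace Z]
    (S : α → Set Z) : Prop where
  nonempty : ∀ x, (S x).Nonempty
  isClosed : ∀ x, IsClosed (S x)
  measurableSet : ∀ C, IsClosed C → MeasurableSet {x | (S x ∩ C).Nonempty}

theorem IsMeasurableClosedMap.argminMap {α Z : Type*} [MeasurableSpace α] [TopologicalSpace Z]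
    [CompactSpace Z] {S : α → Set Z} (hS : IsMeasurableClosedMap S) {g : Z → ℝ}
    (hg : Continuous g) : IsMeasurableClosedMap (argminMap S g) where
  nonempty x := by
    obtain ⟨y, hy, hmin⟩ := (hS.isClosed x).isCompact.exists_isMinOn (hS.nonempty x)
      hg.continuousOn
    exact ⟨y, hy, fun z hz => hmin hz⟩
  isClosed x := by
    have h : Corr.argminMap S g x = S x ∩ ⋂ z ∈ S x, {y | g y ≤ g z} := by
      ext y; simp [Corr.argminMap]
    rw [h]
    exact (hS.isClosed x).inter
      (isClosed_biInter fun z _ => isClosed_le hg continuous_const)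
  measurableSet C hC := by
    have h : {x | (Corr.argminMap S g x ∩ C).Nonempty} = {x | (S x ∩ C).Nonempty} ∩
        ⋂ q : ℚ, ({x | (S x ∩ {y | g y ≤ q}).Nonempty}ᶜ ∪
          {x | (S x ∩ (C ∩ {y | g y ≤ q})).Nonempty}) := by
      ext x
      simp only [mem_ofPred_eq, mem_inter_iff, mem_iInter, mem_union, mem_compl_iff]
      constructor
      · rintro ⟨y, ⟨hy, hmin⟩, hyC⟩
        refine ⟨⟨y, hy, hyC⟩, fun q => ?_⟩
        by_cases hq : (S x ∩ {y | g y ≤ q}).Nonempty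
        · obtain ⟨z, hz, hzq⟩ := hq
          exact Or.inr ⟨y, hy, hyC, (hmin z hz).trans hzq⟩
        · exact Or.inl hq
      · rintro ⟨hne, hq⟩
        obtain ⟨y, hy, hmin⟩ := ((hS.isClosed x).inter hC).isCompact.exists_isMinOn hne
          hg.continuousOn
        refine ⟨y, ⟨hy.1, fun z hz => ?_⟩, hy.2⟩
        by_contra! hlt
        obtain ⟨q, hzq, hqy⟩ := exists_rat_btwn hlt
        rcases hq q with h | ⟨w, hwS, hwC, hwq⟩
        · exact h ⟨z, hz, hzq.le⟩
        · exact absurd ((hmin ⟨hwS, hwC⟩).trans hwq) (not_le.2 hqy)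
    rw [h]
    refine (hS.measurableSet C hC).inter (MeasurableSet.iInter fun q => ?_)
    have hcl : IsClosed {y | g y ≤ (q : ℝ)} := isClosed_le hg continuous_const
    exact (hS.measurableSet _ hcl).compl.union (hS.measurableSet _ (hC.inter hcl))

/-- A weakly measurable map with nonempty closed values in a compact metric space has a
measurable selector. -/
theorem IsMeasurableClosedMap.exists_measurable_selector {α Z : Type*} [MeasurableSpace α]
    [MetricSpace Z] [CompactSpace Z] [MeasurableSpace Z] [BorelSpace Z] [Nonempty Z]
    {S : α → Set Z} (hS : IsMeasurableClosedMap S) :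
    ∃ s : α → Z, Measurable s ∧ ∀ x, s x ∈ S x := by
  let q : ℕ → Z := TopologicalSpace.denseSeq Z
  let R : ℕ → α → Set Z := fun n =>
    Nat.rec S (fun k A => Corr.argminMap A fun y => dist y (q k)) n
  have hR : ∀ n, IsMeasurableClosedMap (R n) := by
    intro n
    induction n with
    | zero => exact hS
    | succ k ih => exact ih.argminMap (continuous_id.dist continuous_const)
  have hanti : ∀ n x, R (n + 1) x ⊆ R n x := fun n x y hy => hy.1
  have hne : ∀ x C, IsClosed C → (∀ n, (R n x ∩ C).Nonempty) →
      ((⋂ n, R n x) ∩ C).Nonempty := by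
    intro x C hC h
    rw [iInter_inter]
    exact IsCompact.nonempty_iInter_of_sequence_nonempty_isCompact_isClosed _
      (fun n => inter_subset_inter_left _ (hanti n x)) h
      (((hR 0).isClosed x).inter hC).isCompact (fun n => ((hR n).isClosed x).inter hC)
  have huniq : ∀ x, ∀ y ∈ ⋂ n, R n x, ∀ z ∈ ⋂ n, R n x, y = z := by
    intro x y hy z hz
    rw [mem_iInter] at hy hz
    have hcl : IsClosed {w : Z | dist y w = dist z w} :=
      isClosed_eq (continuous_const.dist continuous_id) (continuous_const.dist continuous_id)
    have hall : ∀ w, w ∈ {w : Z | dist y w = dist z w} := by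
      intro w
      refine hcl.closure_subset_iff.2 ?_ (TopologicalSpace.denseRange_denseSeq Z w)
      rintro _ ⟨n, rfl⟩
      exact le_antisymm ((hy (n + 1)).2 z (hz n)) ((hz (n + 1)).2 y (hy n))
    have := hall y
    rw [mem_ofPred_eq, dist_self] at this
    exact (dist_eq_zero.1 this.symm).symm
  have hex : ∀ x, ∃ y, y ∈ ⋂ n, R n x := fun x =>
    let ⟨y, hy⟩ := hne x univ isClosed_univ fun n => by simpa using! (hR n).nonempty x
    ⟨y, hy.1⟩
  choose s hs using hex
  refine ⟨s, measurable_of_isClosed fun C hC => ?_, fun x => mem_iInter.1 (hs x) 0⟩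
  have h : s ⁻¹' C = ⋂ n, {x | (R n x ∩ C).Nonempty} := by
    ext x
    simp only [mem_preimage, mem_iInter, mem_ofPred_eq]
    constructor
    · exact fun hx n => ⟨s x, mem_iInter.1 (hs x) n, hx⟩
    · intro hx
      obtain ⟨y, hy, hyC⟩ := hne x C hC hx
      rwa [huniq x (s x) (hs x) y hy]
  rw [h]
  exact MeasurableSet.iInter fun n => (hR n).measurableSet C hC

theorem IsCorrespondence.isMeasurableClosedMap {X : Type*} [MetricSpace X] [CompactSpace X]
    [MeasurableSpace X] [BorelSpace X] {T : X → Set X} (hT : IsCorrespondence T) :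
    IsMeasurableClosedMap T where
  nonempty := hT.1
  isClosed := hT.2.1
  measurableSet C hC := by
    have h : {x | (T x ∩ C).Nonempty} =
        Prod.fst '' ({p : X × X | p.2 ∈ T p.1} ∩ Prod.snd ⁻¹' C) := by
      ext x
      constructor
      · rintro ⟨y, hy, hyC⟩
        exact ⟨(x, y), ⟨hy, hyC⟩, rfl⟩
      · rintro ⟨⟨_, y⟩, ⟨hy, hyC⟩, rfl⟩
        exact ⟨y, hy, hyC⟩
    rw [h]
    exact ((hT.2.2.inter (hC.preimage continuous_snd)).isCompact.image
      continuous_fst).isClosed.measurableSet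

/-- A stationary two-step law carried by the graph of `T` comes from a kernel supported by
`T`. -/
theorem IsCorrespondence.exists_kernel_of_fst_eq_snd {X : Type*} [MetricSpace X]
    [CompactSpace X] [Nonempty X] [MeasurableSpace X] [BorelSpace X] {T : X → Set X}
    (hT : IsCorrespondence T) (ν : Measure (X × X)) [IsProbabilityMeasure ν]
    (hinv : ν.fst = ν.snd) (hν : ∀ᵐ p ∂ν, p.2 ∈ T p.1) :
    ∃ Q : X → Measure X, IsTransKernel Q ∧ SupportedBy T Q ∧ ν.fst.bind Q = ν.fst := by
  obtain ⟨s, hs, hsT⟩ := hT.isMeasurableClosedMap.exists_measurable_selector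
  have hG : MeasurableSet {p : X × X | p.2 ∈ T p.1} := hT.2.2.measurableSet
  let κ := ν.condKernel
  have hκ : ν.fst.compProd κ = ν := ν.disintegrate κ
  have hmeas : Measurable fun x => κ x (T x) :=
    ProbabilityTheory.Kernel.measurable_kernel_prodMk_left hG
  have hN : MeasurableSet {x | κ x (T x) = 1} := hmeas (measurableSet_singleton 1)
  have hae : ∀ᵐ x ∂ν.fst, κ x (T x) = 1 := by
    have h := Measure.ae_ae_of_ae_compProd (hκ.symm ▸ hν)
    filter_upwards [h] with x hx
    exact (prob_compl_eq_zero_iff (hT.2.1 x).measurableSet).1 hx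
  let Q : X → Measure X := fun x => if κ x (T x) = 1 then κ x else Measure.dirac (s x)
  have hQ : Q =ᵐ[ν.fst] κ := by
    filter_upwards [hae] with x hx
    exact if_pos hx
  refine ⟨Q, ⟨Measurable.ite hN κ.measurable (Measure.measurable_dirac.comp hs), fun x => ?_⟩,
    fun x => ?_, ?_⟩
  · by_cases hx : κ x (T x) = 1
    · simp only [Q, if_pos hx]; infer_instance
    · simp only [Q, if_neg hx]; infer_instance
  · by_cases hx : κ x (T x) = 1
    · simp only [Q, if_pos hx]
      exact hx
    · simp only [Q, if_neg hx]
      rw [Measure.dirac_apply' _ (hT.2.1 x).measurableSet, indicator_of_mem (hsT x)]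
      rfl
  · rw [Measure.bind_congr_right hQ, ← Measure.snd_compProd, hκ, hinv]

/-- The uniform probability measure on the first `n` terms of the sequence `z`. -/
noncomputable def empiricalMeasure {Z : Type*} [MeasurableSpace Z] (z : ℕ → Z) (n : ℕ) :
    Measure Z :=
  (n : ℝ≥0∞)⁻¹ • ∑ i ∈ Finset.range n, Measure.dirac (z i)

theorem isProbabilityMeasure_empiricalMeasure {Z : Type*} [MeasurableSpace Z] (z : ℕ → Z)
    {n : ℕ} (hn : n ≠ 0) : IsProbabilityMeasure (empiricalMeasure z n) := by
  constructor
  simp only [empiricalMeasure, Measure.smul_apply, Measure.finsetSum_apply, measure_univ,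
    Finset.sum_const, Finset.card_range, nsmul_eq_mul, mul_one, smul_eq_mul]
  exact ENNReal.inv_mul_cancel (by exact_mod_cast hn) (ENNReal.natCast_ne_top n)

theorem integral_empiricalMeasure {Z : Type*} [MeasurableSpace Z] (z : ℕ → Z) (n : ℕ)
    {f : Z → ℝ} (hf : StronglyMeasurable f) :
    ∫ p, f p ∂(empiricalMeasure z n) = (n : ℝ)⁻¹ * ∑ i ∈ Finset.range n, f (z i) := by
  rw [empiricalMeasure, integral_smul_measure, integral_finsetSum_measure]
  · simp [integral_dirac' _ _ hf]
  · intro i _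
    exact (integrable_dirac' hf (by simp))

/-- Along any sequence of lengths and sequences, the empirical averages of continuous functions
converge along the hyperfilter to integrals against a probability measure. -/
theorem exists_tendsto_empirical_average {Z : Type*} [MetricSpace Z] [CompactSpace Z]
    [MeasurableSpace Z] [BorelSpace Z] (z : ℕ → ℕ → Z) (n : ℕ → ℕ) (hn : ∀ k, n k ≠ 0) :
    ∃ ν : Measure Z, IsProbabilityMeasure ν ∧ ∀ f : Z → ℝ, Continuous f →
      Tendsto (fun k => (n k : ℝ)⁻¹ * ∑ i ∈ Finset.range (n k), f (z k i))
        (hyperfilter ℕ : Filter ℕ) (𝓝 (∫ p, f p ∂ν)) := by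
  let P : ℕ → ProbabilityMeasure Z := fun k =>
    ⟨empiricalMeasure (z k) (n k), isProbabilityMeasure_empiricalMeasure _ (hn k)⟩
  have : Nonempty (ProbabilityMeasure Z) := ⟨P 0⟩
  obtain ⟨ν, -, hν⟩ := isCompact_univ.ultrafilter_le_nhds' ((hyperfilter ℕ).map P) univ_mem
  have hP : Tendsto P (hyperfilter ℕ : Filter ℕ) (𝓝 ν) := hν
  refine ⟨ν, inferInstance, fun f hf => ?_⟩
  have h := ProbabilityMeasure.tendsto_iff_forall_integral_tendsto.1 hP
    (BoundedContinuousFunction.mkOfCompact ⟨f, hf⟩)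
  refine h.congr fun k => ?_
  exact integral_empiricalMeasure (z k) (n k) hf.stronglyMeasurable

/-- If every invariant measure of every kernel supported by `T` is carried by `Y`, then the
average distance to `Y` along orbits of `T` tends to zero uniformly. -/
theorem IsCorrespondence.exists_forall_sum_infDist_le {X : Type*} [MetricSpace X]
    [CompactSpace X] [MeasurableSpace X] [BorelSpace X] {T : X → Set X}
    (hT : IsCorrespondence T) {Y : Set X}
    (hfull : ∀ μ : Measure X, IsProbabilityMeasure μ →
      (∃ Q : X → Measure X, IsTransKernel Q ∧ SupportedBy T Q ∧ μ.bind Q = μ) → μ Y = 1)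
    (hYc : IsClosed Y) {δ : ℝ} (hδ : 0 < δ) :
    ∃ N : ℕ, ∀ n ≥ N, ∀ x ∈ orbitSpace T,
      ∑ i ∈ Finset.range n, Metric.infDist (x i) Y ≤ δ * n := by
  by_contra! hcon
  choose n hn x hx hlt using hcon
  have : Nonempty X := ⟨x 0 0⟩
  have hn0 : ∀ k, n k ≠ 0 := by
    intro k hk
    have := hlt k
    simp [hk] at this
  have hnpos : ∀ k, (0 : ℝ) < n k := fun k => by exact_mod_cast (hn0 k).bot_lt
  obtain ⟨ν, hνp, hν⟩ := exists_tendsto_empirical_average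
    (fun k i => (x k i, x k (i + 1))) n hn0
  have hinvn : Tendsto (fun k => (n k : ℝ)⁻¹) (hyperfilter ℕ : Filter ℕ) (𝓝 0) := by
    have h1 : Tendsto n atTop atTop := tendsto_atTop_mono hn tendsto_id
    exact ((tendsto_inv_atTop_zero.comp tendsto_natCast_atTop_atTop).comp h1).mono_left
      Nat.hyperfilter_le_atTop
  have hinv : ν.fst = ν.snd := by
    refine ext_of_forall_integral_eq_of_IsFiniteMeasure fun f => ?_
    rw [Measure.fst, Measure.snd,
      integral_map measurable_fst.aemeasurable f.continuous.aestronglyMeasurable,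
      integral_map measurable_snd.aemeasurable f.continuous.aestronglyMeasurable]
    have h1 := (hν (fun p => f p.1) (by fun_prop)).sub (hν (fun p => f p.2) (by fun_prop))
    have h2 : Tendsto (fun k => (n k : ℝ)⁻¹ * (f (x k 0) - f (x k (n k))))
        (hyperfilter ℕ : Filter ℕ) (𝓝 0) := by
      refine squeeze_zero_norm (a := fun k => (n k : ℝ)⁻¹ * (2 * ‖f‖)) (fun k => ?_) ?_
      · rw [norm_mul, Real.norm_of_nonneg (inv_nonneg.2 (hnpos k).le)]
        refine mul_le_mul_of_nonneg_left ?_ (inv_nonneg.2 (hnpos k).le)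
        exact (dist_eq_norm (f (x k 0)) _) ▸ f.dist_le_two_norm _ _
      · simpa using hinvn.mul_const (2 * ‖f‖)
    refine sub_eq_zero.1 (tendsto_nhds_unique (h1.congr fun k => ?_) h2)
    rw [← mul_sub, ← Finset.sum_sub_distrib, Finset.sum_range_sub' (fun i => f (x k i))]
  have hgraph : ∀ᵐ p ∂ν, p.2 ∈ T p.1 := by
    let G := {p : X × X | p.2 ∈ T p.1}
    have hGne : G.Nonempty := ⟨(x 0 0, x 0 1), hx 0 0⟩
    have hc : Continuous fun p : X × X => Metric.infDist p G := Metric.continuous_infDist_pt G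
    have h0 : ∫ p, Metric.infDist p G ∂ν = 0 := by
      refine tendsto_nhds_unique (hν _ hc) (tendsto_const_nhds.congr fun k => ?_)
      rw [Finset.sum_eq_zero, mul_zero]
      exact fun i _ => Metric.infDist_zero_of_mem (hx k i)
    rw [integral_eq_zero_iff_of_nonneg (fun _ => Metric.infDist_nonneg)
      (hc.integrable_of_hasCompactSupport (HasCompactSupport.of_compactSpace _))] at h0
    filter_upwards [h0] with p hp
    exact (hT.2.2.mem_iff_infDist_zero hGne).2 hp
  have hY : ν.fst Y = 1 :=
    hfull ν.fst inferInstance (hT.exists_kernel_of_fst_eq_snd ν hinv hgraph)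
  have hYae : ∀ᵐ a ∂ν.fst, a ∈ Y := (prob_compl_eq_zero_iff hYc.measurableSet).2 hY
  have h0 : ∫ p, Metric.infDist p.1 Y ∂ν = 0 := by
    rw [integral_eq_zero_of_ae]
    filter_upwards [ae_of_ae_map measurable_fst.aemeasurable hYae] with p hp
    exact Metric.infDist_zero_of_mem hp
  have hge : δ ≤ ∫ p, Metric.infDist p.1 Y ∂ν := by
    refine ge_of_tendsto (hν (fun p => Metric.infDist p.1 Y)
      ((Metric.continuous_infDist_pt Y).comp continuous_fst)) (Eventually.of_forall fun k => ?_)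
    rw [inv_mul_eq_div, le_div_iff₀ (hnpos k)]
    exact (hlt k).le
  linarith

/-- The exponential weight `exp (∑_{i<n} Φ(x_i, x_{i+1}))` of the start of a sequence. -/
noncomputable def seqWeight {X : Type*} (Φ : X × X → ℝ) (n : ℕ) (x : ℕ → X) : ℝ≥0∞ :=
  ENNReal.ofReal (Real.exp (∑ i ∈ Finset.range n, Φ (x i, x (i + 1))))

theorem seqWeight_add {X : Type*} {Φ : X × X → ℝ} (M n : ℕ) (x : ℕ → X) :
    seqWeight Φ (M + n) x = seqWeight Φ M x * seqWeight Φ n fun i => x (M + i) := by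
  simp only [seqWeight, Finset.sum_range_add, Real.exp_add, add_assoc]
  exact ENNReal.ofReal_mul (Real.exp_pos _).le

/-- The supremum of `∑_{x ∈ E} exp (∑_{i<n} Φ(x_i, x_{i+1}))` over sets `E` of infinite orbits
of `T` whose distinct elements are at distance `≥ ε` in one of their first `n` coordinates. -/
noncomputable def orbitSup {X : Type*} [MetricSpace X] (T : X → Set X) (Φ : X × X → ℝ) (ε : ℝ)
    (n : ℕ) : ℝ≥0∞ :=
  ⨆ (E : Set (ℕ → X)) (_ : E ⊆ orbitSpace T)
    (_ : ∀ x ∈ E, ∀ y ∈ E, x ≠ y → ∃ i < n, ε ≤ dist (x i) (y i)), ∑' x : E, seqWeight Φ n x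

theorem exists_orbit_extension {X : Type*} {T : X → Set X}
    (hT : ∀ x, (T x).Nonempty) {n : ℕ} (x : Fin (n + 1) → X) :
    ∃ y : ℕ → X, (x ∈ finOrbits T n → y ∈ orbitSpace T) ∧ ∀ i : Fin (n + 1), y i = x i := by
  choose s hs using hT
  refine ⟨fun k => if h : k < n + 1 then x ⟨k, h⟩ else s^[k - n] (x (Fin.last n)),
    fun hx k => ?_, fun i => dif_pos i.2⟩
  beta_reduce
  rcases lt_trichotomy k n with h | rfl | h
  · rw [dif_pos (by omega), dif_pos (by omega)]
    exact hx ⟨k, h⟩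
  · rw [dif_neg (lt_irrefl (k + 1)), dif_pos (Nat.lt_succ_self k)]
    simpa [Fin.last] using! hs (x (Fin.last k))
  · rw [dif_neg (by omega), dif_neg (by omega), show k + 1 - n = (k - n) + 1 by omega,
      Function.iterate_succ_apply']
    exact hs _

section OrbitSup

variable {X : Type*} [MetricSpace X] {T : X → Set X} {Φ : X × X → ℝ} {ε : ℝ}

theorem tsum_le_orbitSup {n : ℕ} {E : Set (ℕ → X)} (hE : E ⊆ orbitSpace T)
    (hsep : ∀ x ∈ E, ∀ y ∈ E, x ≠ y → ∃ i < n, ε ≤ dist (x i) (y i)) :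
    ∑' x : E, seqWeight Φ n x ≤ orbitSup T Φ ε n :=
  le_iSup_of_le E (le_iSup_of_le hE (le_iSup_of_le hsep le_rfl))

theorem orbitSup_zero_le : orbitSup T Φ ε 0 ≤ 1 := by
  refine iSup_le fun E => iSup_le fun _ => iSup_le fun hsep => ?_
  have hsub : E.Subsingleton := by
    intro x hx y hy
    by_contra hne
    obtain ⟨i, hi, -⟩ := hsep x hx y hy hne
    exact absurd hi (Nat.not_lt_zero i)
  rcases hsub.eq_empty_or_singleton with rfl | ⟨x, rfl⟩
  · simp
  · simp [seqWeight]

/-- Submultiplicativity: if the first `M` coordinates of orbits are coded by symbols `j : J`,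
each determining them up to `ε` and bounding their weight by `c j`, then splitting off these
coordinates costs at most `∑_j c j`. -/
theorem orbitSup_add_le (hε : 0 < ε) {J : Type*} {M : ℕ} (B : J → Set (ℕ → X)) (c : J → ℝ≥0∞)
    (hcov : ∀ x ∈ orbitSpace T, ∃ j, x ∈ B j)
    (hsmall : ∀ j, ∀ x ∈ B j, ∀ y ∈ B j, ∀ i < M, dist (x i) (y i) < ε)
    (hc : ∀ j, ∀ x ∈ B j, x ∈ orbitSpace T → seqWeight Φ M x ≤ c j) (n : ℕ) :
    orbitSup T Φ ε (M + n) ≤ (∑' j, c j) * orbitSup T Φ ε n := by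
  refine iSup_le fun E => iSup_le fun hE => iSup_le fun hsep => ?_
  let sh : (ℕ → X) → ℕ → X := fun x i => x (M + i)
  have hsepB : ∀ j, ∀ x ∈ E ∩ B j, ∀ y ∈ E ∩ B j, x ≠ y →
      ∃ i < n, ε ≤ dist (sh x i) (sh y i) := by
    intro j x hx y hy hne
    obtain ⟨i, hi, hd⟩ := hsep x hx.1 y hy.1 hne
    rcases lt_or_ge i M with hiM | hiM
    · exact absurd hd (not_le.2 (hsmall j x hx.2 y hy.2 i hiM))
    · obtain ⟨k, rfl⟩ := Nat.exists_eq_add_of_le hiM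
      exact ⟨k, by omega, hd⟩
  have hinj : ∀ j, InjOn sh (E ∩ B j) := by
    intro j x hx y hy hxy
    by_contra hne
    obtain ⟨i, -, hd⟩ := hsepB j x hx y hy hne
    rw [hxy, dist_self] at hd
    linarith
  have hpiece : ∀ j, ∑' x : ↥(E ∩ B j), seqWeight Φ (M + n) x ≤ c j * orbitSup T Φ ε n := by
    intro j
    calc ∑' x : ↥(E ∩ B j), seqWeight Φ (M + n) x
        ≤ ∑' x : ↥(E ∩ B j), c j * seqWeight Φ n (sh x) := by
          refine ENNReal.tsum_le_tsum fun x => ?_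
          rw [seqWeight_add]
          exact mul_le_mul_left (hc j x x.2.2 (hE x.2.1)) _
      _ = c j * ∑' y : ↥(sh '' (E ∩ B j)), seqWeight Φ n y := by
          rw [ENNReal.tsum_mul_left, tsum_image (seqWeight Φ n) (hinj j)]
      _ ≤ c j * orbitSup T Φ ε n := by
          refine mul_le_mul_right (tsum_le_orbitSup ?_ ?_) _
          · rintro _ ⟨x, hx, rfl⟩ k
            exact hE hx.1 (M + k)
          · rintro _ ⟨x, hx, rfl⟩ _ ⟨y, hy, rfl⟩ hne
            exact hsepB j x hx y hy fun h => hne (h ▸ rfl)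
  have hEcov : E ⊆ ⋃ j, E ∩ B j := fun x hx =>
    let ⟨j, hj⟩ := hcov x (hE hx)
    mem_iUnion.2 ⟨j, hx, hj⟩
  calc ∑' x : E, seqWeight Φ (M + n) x
      ≤ ∑' x : ↥(⋃ j, E ∩ B j), seqWeight Φ (M + n) x := ENNReal.tsum_mono_subtype _ hEcov
    _ ≤ ∑' j, ∑' x : ↥(E ∩ B j), seqWeight Φ (M + n) x := ENNReal.tsum_iUnion_le_tsum _ _
    _ ≤ ∑' j, c j * orbitSup T Φ ε n := ENNReal.tsum_le_tsum hpiece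
    _ = (∑' j, c j) * orbitSup T Φ ε n := ENNReal.tsum_mul_right

theorem exists_finset_dist_lt (X : Type*) [MetricSpace X] [CompactSpace X] {r : ℝ} (hr : 0 < r) :
    ∃ t : Finset X, ∀ x, ∃ c ∈ t, dist x c < r := by
  obtain ⟨t, -, ht, hcov⟩ := finite_cover_balls_of_compact (isCompact_univ (X := X)) hr
  refine ⟨ht.toFinset, fun x => ?_⟩
  obtain ⟨c, hc, hx⟩ := mem_iUnion₂.1 (hcov (mem_univ x))
  exact ⟨c, ht.mem_toFinset.2 hc, hx⟩

theorem exists_orbitSup_le_exp_mul [CompactSpace X] (hε : 0 < ε) {C : ℝ}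
    (hΦ : ∀ p, Φ p ≤ C) :
    ∃ a : ℝ, 0 ≤ a ∧ ∀ n, orbitSup T Φ ε n ≤ ENNReal.ofReal (Real.exp (a * n)) := by
  obtain ⟨t, ht⟩ := exists_finset_dist_lt X (half_pos hε)
  obtain ⟨a, ha⟩ : ∃ a : ℝ, (t.card : ℝ) * Real.exp C ≤ Real.exp a :=
    (Real.tendsto_exp_atTop.eventually_ge_atTop _).exists
  refine ⟨max a 0, le_max_right _ _, fun n => ?_⟩
  induction n with
  | zero => simpa using! orbitSup_zero_le
  | succ n ih =>
    have h := orbitSup_add_le (T := T) (Φ := Φ) hε (M := 1)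
      (fun j : t => {x : ℕ → X | dist (x 0) j < ε / 2})
      (fun _ => ENNReal.ofReal (Real.exp C))
      (fun x _ => let ⟨c, hc, hx⟩ := ht (x 0); ⟨⟨c, hc⟩, hx⟩)
      (fun j x hx y hy i hi => by
        obtain rfl : i = 0 := by omega
        have := dist_triangle_right (x 0) (y 0) (j : X)
        simp only [mem_ofPred_eq] at hx hy
        linarith)
      (fun j x _ _ => by
        refine ENNReal.ofReal_le_ofReal (Real.exp_le_exp.2 ?_)
        simpa using! hΦ (x 0, x 1)) n
    rw [add_comm]
    refine h.trans ?_
    have hsum : ∑' _ : t, ENNReal.ofReal (Real.exp C) ≤ ENNReal.ofReal (Real.exp (max a 0)) := by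
      rw [tsum_fintype, Finset.sum_const, nsmul_eq_mul, Finset.card_univ, Fintype.card_coe,
        ← ENNReal.ofReal_natCast, ← ENNReal.ofReal_mul (Nat.cast_nonneg _)]
      exact ENNReal.ofReal_le_ofReal (ha.trans (Real.exp_le_exp.2 (le_max_left _ _)))
    refine (mul_le_mul' hsum ih).trans_eq ?_
    rw [← ENNReal.ofReal_mul (Real.exp_pos _).le, ← Real.exp_add]
    congr 2
    push_cast
    ring

/-- A block bound `exp (M t)` for blocks of length `M` yields exponential growth rate at most
`t`. -/
theorem exists_orbitSup_le_exp_add [CompactSpace X] (hε : 0 < ε) {C : ℝ} (hΦ : ∀ p, Φ p ≤ C)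
    {M : ℕ} (hM : 0 < M) {t : ℝ}
    (hblock : ∀ n, orbitSup T Φ ε (M + n) ≤
      ENNReal.ofReal (Real.exp (M * t)) * orbitSup T Φ ε n) :
    ∃ D : ℝ, ∀ n : ℕ, orbitSup T Φ ε n ≤ ENNReal.ofReal (Real.exp (D + n * t)) := by
  obtain ⟨a, ha0, ha⟩ := exists_orbitSup_le_exp_mul (T := T) hε hΦ
  refine ⟨M * (a + |t|), fun n => ?_⟩
  induction n using Nat.strong_induction_on with
  | _ n ih =>
    rcases lt_or_ge n M with hn | hn
    · refine (ha n).trans (ENNReal.ofReal_le_ofReal (Real.exp_le_exp.2 ?_))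
      have hnM : (n : ℝ) ≤ M := by exact_mod_cast hn.le
      have h1 : (n : ℝ) * a ≤ M * a := mul_le_mul_of_nonneg_right hnM ha0
      have h2 : (n : ℝ) * |t| ≤ M * |t| := mul_le_mul_of_nonneg_right hnM (abs_nonneg t)
      have h3 : (n : ℝ) * -|t| ≤ n * t :=
        mul_le_mul_of_nonneg_left (neg_abs_le t) (Nat.cast_nonneg n)
      linarith
    · obtain ⟨k, rfl⟩ := Nat.exists_eq_add_of_le hn
      refine (hblock k).trans ((mul_le_mul_right (ih k (by omega)) _).trans_eq ?_)
      rw [← ENNReal.ofReal_mul (Real.exp_pos _).le, ← Real.exp_add]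
      congr 2
      push_cast
      ring

/-- Every finite orbit extends to an infinite one. -/
theorem sepSup_le_orbitSup (hT : ∀ x, (T x).Nonempty) (hε : 0 < ε) (φ : ↥(graph2 T) → ℝ)
    {n : ℕ} {a : ℝ}
    (ha : ∀ x ∈ orbitSpace T, ∑ i ∈ Finset.range n, ext2 T φ (x i, x (i + 1)) ≤
      a + ∑ i ∈ Finset.range (n + 1), Φ (x i, x (i + 1))) :
    sepSup T φ n ε ≤ ENNReal.ofReal (Real.exp a) * orbitSup T Φ ε (n + 1) := by
  refine iSup_le fun E => iSup_le fun hE => iSup_le fun hsep => ?_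
  choose e he hex using fun x : Fin (n + 1) → X => exists_orbit_extension hT x
  have hinj : InjOn e E := by
    intro x hx y hy hxy
    funext i
    rw [← hex x i, ← hex y i, hxy]
  calc orbSum T φ n E
      ≤ ∑' x : E, ENNReal.ofReal (Real.exp a) * seqWeight Φ (n + 1) (e x) := by
        refine ENNReal.tsum_le_tsum fun x => ?_
        rw [seqWeight, ← ENNReal.ofReal_mul (Real.exp_pos _).le, ← Real.exp_add]
        refine ENNReal.ofReal_le_ofReal (Real.exp_le_exp.2 ?_)
        refine le_trans (le_of_eq ?_) (ha (e x) (he x (hE x.2)))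
        rw [birkhoff, ← Fin.sum_univ_eq_sum_range
          (fun i => ext2 T φ (e x i, e x (i + 1)))]
        refine Finset.sum_congr rfl fun i _ => ?_
        rw [← hex x i.castSucc, ← hex x i.succ, Fin.val_castSucc, Fin.val_succ]
    _ = ENNReal.ofReal (Real.exp a) * ∑' y : ↥(e '' E), seqWeight Φ (n + 1) y := by
        rw [ENNReal.tsum_mul_left, tsum_image (seqWeight Φ (n + 1)) hinj]
    _ ≤ ENNReal.ofReal (Real.exp a) * orbitSup T Φ ε (n + 1) := by
        refine mul_le_mul_right (tsum_le_orbitSup ?_ ?_) _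
        · rintro _ ⟨x, hx, rfl⟩
          exact he x (hE hx)
        · rintro _ ⟨x, hx, rfl⟩ _ ⟨y, hy, rfl⟩ hne
          have hd := hsep x hx y hy fun h => hne (h ▸ rfl)
          by_contra! hlt
          refine absurd hd (not_le.2 ((dist_pi_lt_iff hε).2 fun i => ?_))
          rw [← hex x i, ← hex y i]
          exact hlt i i.2

end OrbitSup

theorem exists_maximal_eSep {Z : Type*} [PseudoMetricSpace Z] {ε : ℝ} (S : Set Z) :
    ∃ F ⊆ S, eSep ε F ∧ ∀ y ∈ S, y ∈ F ∨ ∃ x ∈ F, dist y x < ε := by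
  obtain ⟨F, hF⟩ := zorn_subset {F : Set Z | F ⊆ S ∧ eSep ε F} (by
    intro c hc hchain
    refine ⟨⋃₀ c, ⟨sUnion_subset fun s hs => (hc hs).1, ?_⟩, fun s hs => subset_sUnion_of_mem hs⟩
    rintro x ⟨s, hs, hx⟩ y ⟨t, ht, hy⟩ hne
    rcases hchain.total hs ht with h | h
    · exact (hc ht).2 x (h hx) y hy hne
    · exact (hc hs).2 x hx y (h hy) hne)
  refine ⟨F, hF.prop.1, hF.prop.2, fun y hy => ?_⟩
  by_contra! hcon
  refine hcon.1 (hF.le_of_ge (y := insert y F) ⟨insert_subset hy hF.prop.1, ?_⟩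
    (subset_insert y F) (mem_insert y F))
  rintro a (rfl | ha) b (rfl | hb) hne
  · exact absurd rfl hne
  · exact hcon.2 b hb
  · rw [dist_comm]
    exact hcon.2 a ha
  · exact hF.prop.2 a ha b hb hne

/-- The restriction `T|_Y` of a correspondence. -/
abbrev restrictCorr {X : Type*} (T : X → Set X) (Y : Set X) (y : ↥Y) : Set ↥Y :=
  {z : ↥Y | (z : X) ∈ T y}

/-- The restriction of a potential on the graph of `T` to the graph of `T|_Y`. -/
abbrev restrictPot {X : Type*} (T : X → Set X) (Y : Set X) (φ : ↥(graph2 T) → ℝ)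
    (q : ↥(graph2 (restrictCorr T Y))) : ℝ :=
  φ ⟨((q.1.1 : X), (q.1.2 : X)), q.2⟩

theorem ext2_restrict {X : Type*} (T : X → Set X) (Y : Set X) (φ : ↥(graph2 T) → ℝ) (a b : ↥Y) :
    ext2 (restrictCorr T Y) (restrictPot T Y φ) (a, b) = ext2 T φ (a, b) := by
  unfold ext2
  by_cases h : ((a : X), (b : X)) ∈ graph2 T
  · rw [dif_pos h, dif_pos (show (a, b) ∈ graph2 (restrictCorr T Y) from h)]
  · rw [dif_neg h, dif_neg (show (a, b) ∉ graph2 (restrictCorr T Y) from h)]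

theorem sepSup_restrict_le {X : Type*} [MetricSpace X] (T : X → Set X) (Y : Set X)
    (φ : ↥(graph2 T) → ℝ) (n : ℕ) (ε : ℝ) :
    sepSup (restrictCorr T Y) (restrictPot T Y φ) n ε ≤ sepSup T φ n ε := by
  refine iSup_le fun E => iSup_le fun hE => iSup_le fun hsep => ?_
  let e : (Fin (n + 1) → ↥Y) → Fin (n + 1) → X := fun y i => y i
  have hinj : Function.Injective e := fun x y h =>
    funext fun i => Subtype.ext (congrFun h i)
  refine le_iSup_of_le (e '' E) (le_iSup_of_le ?_ (le_iSup_of_le ?_ ?_))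
  · rintro _ ⟨y, hy, rfl⟩ i
    exact hE hy i
  · rintro _ ⟨x, hx, rfl⟩ _ ⟨y, hy, rfl⟩ hne
    exact hsep x hx y hy fun h => hne (h ▸ rfl)
  · rw [orbSum, orbSum,
      tsum_image (fun x => ENNReal.ofReal (Real.exp (birkhoff T φ x))) hinj.injOn]
    simp only [birkhoff, ext2_restrict, e]
    exact le_rfl

/-- Orbit segments of `T` staying close enough to `Y` are shadowed by orbits of `T|_Y`. -/
theorem IsCorrespondence.exists_shadow {X : Type*} [MetricSpace X] [CompactSpace X]
    {T : X → Set X} (hT : IsCorrespondence T) {Y : Set X} (hYc : IsClosed Y)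
    (hYne : Y.Nonempty) (m : ℕ) {ε : ℝ} (hε : 0 < ε) :
    ∃ r > 0, ∀ z ∈ finOrbits T m, (∀ i, Metric.infDist (z i) Y < r) →
      ∃ y ∈ finOrbits (restrictCorr T Y) m, ∀ i, dist (z i) (y i) < ε := by
  let V : Set (Fin (m + 1) → X) :=
    ⋃ y ∈ finOrbits (restrictCorr T Y) m, ⋂ i, {z | dist (z i) (y i) < ε}
  have hV : IsOpen V := isOpen_biUnion fun y _ => isOpen_iInter_of_finite fun i =>
    isOpen_lt ((continuous_apply i).dist continuous_const) continuous_const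
  have hK : IsClosed (finOrbits T m) := by
    have h : finOrbits T m = ⋂ i : Fin m, (fun z : Fin (m + 1) → X => (z i.castSucc, z i.succ)) ⁻¹'
        {p : X × X | p.2 ∈ T p.1} := by
      ext z; simp [finOrbits, IsFinOrbit]
    rw [h]
    exact isClosed_iInter fun i => hT.2.2.preimage (by fun_prop)
  have hKV : IsCompact (finOrbits T m \ V) := (hK.sdiff hV).isCompact
  have hpos : ∀ z ∈ finOrbits T m \ V, 0 < ∑ i, Metric.infDist (z i) Y := by
    intro z hz
    refine (Finset.sum_nonneg fun i _ => Metric.infDist_nonneg).lt_of_ne' fun h0 => hz.2 ?_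
    rw [Finset.sum_eq_zero_iff_of_nonneg fun i _ => Metric.infDist_nonneg] at h0
    have hzY : ∀ i, z i ∈ Y := fun i =>
      (hYc.mem_iff_infDist_zero hYne).2 (h0 i (Finset.mem_univ i))
    refine mem_iUnion₂.2 ⟨fun i => ⟨z i, hzY i⟩, fun i => hz.1 i, ?_⟩
    simpa using! hε
  have hmain : ∃ r > 0, ∀ z ∈ finOrbits T m \ V, ∃ i, r ≤ Metric.infDist (z i) Y := by
    rcases (finOrbits T m \ V).eq_empty_or_nonempty with he | hne
    · exact ⟨1, one_pos, by simp [he]⟩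
    · have hcont : Continuous fun z : Fin (m + 1) → X => ∑ i, Metric.infDist (z i) Y :=
        continuous_finsetSum _ fun i _ =>
          (Metric.continuous_infDist_pt Y).comp (continuous_apply i)
      obtain ⟨z₀, hz₀, hmin⟩ := hKV.exists_isMinOn hne hcont.continuousOn
      refine ⟨(∑ i, Metric.infDist (z₀ i) Y) / (m + 1), div_pos (hpos z₀ hz₀) (by positivity),
        fun z hz => ?_⟩
      by_contra! hlt
      have h1 : ∑ i, Metric.infDist (z i) Y <
          ∑ _i : Fin (m + 1), (∑ i, Metric.infDist (z₀ i) Y) / (m + 1) :=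
        Finset.sum_lt_sum_of_nonempty Finset.univ_nonempty fun i _ => hlt i
      rw [Finset.sum_const, Finset.card_univ, Fintype.card_fin, nsmul_eq_mul] at h1
      push_cast at h1
      rw [mul_div_cancel₀ _ (by positivity)] at h1
      exact absurd (hmin hz) (not_le.2 h1)
  obtain ⟨r, hr, hmain⟩ := hmain
  refine ⟨r, hr, fun z hz hlt => ?_⟩
  by_contra hcon
  have hzV : z ∉ V := fun hzV => by
    obtain ⟨y, hy, h⟩ := mem_iUnion₂.1 hzV
    exact hcon ⟨y, hy, fun i => mem_iInter.1 h i⟩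
  obtain ⟨i, hi⟩ := hmain z ⟨hz, hzV⟩
  exact absurd hi (not_le.2 (hlt i))

theorem IsCorrespondence.compactSpace_graph2 {X : Type*} [MetricSpace X] [CompactSpace X]
    {T : X → Set X} (hT : IsCorrespondence T) : CompactSpace ↥(graph2 T) :=
  isCompact_iff_compactSpace.1 hT.2.2.isCompact

theorem IsCorrespondence.exists_abs_ext2_le {X : Type*} [MetricSpace X] [CompactSpace X]
    {T : X → Set X} (hT : IsCorrespondence T) {φ : ↥(graph2 T) → ℝ} (hφ : Continuous φ) :
    ∃ C : ℝ, 0 ≤ C ∧ ∀ p, |ext2 T φ p| ≤ C := by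
  have := hT.compactSpace_graph2
  obtain ⟨C, hC⟩ := isCompact_univ.exists_bound_of_continuousOn hφ.continuousOn
  refine ⟨max C 0, le_max_right _ _, fun p => ?_⟩
  unfold ext2
  split_ifs with h
  · exact (hC ⟨p, h⟩ (mem_univ _)).trans (le_max_left _ _)
  · simp

theorem IsCorrespondence.exists_modulus {X : Type*} [MetricSpace X] [CompactSpace X]
    {T : X → Set X} (hT : IsCorrespondence T) {φ : ↥(graph2 T) → ℝ} (hφ : Continuous φ)
    {η : ℝ} (hη : 0 < η) :
    ∃ ρ > 0, ∀ p ∈ graph2 T, ∀ q ∈ graph2 T, dist p q < ρ →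
      ext2 T φ p ≤ η + ext2 T φ q := by
  have := hT.compactSpace_graph2
  obtain ⟨ρ, hρ, h⟩ := Metric.uniformContinuous_iff.1
    (CompactSpace.uniformContinuous_of_continuous hφ) η hη
  refine ⟨ρ, hρ, fun p hp q hq hpq => ?_⟩
  rw [ext2, ext2, dif_pos hp, dif_pos hq]
  have := (abs_lt.1 (Real.dist_eq _ _ ▸ h (a := ⟨p, hp⟩) (b := ⟨q, hq⟩) hpq)).2
  linarith

theorem elog_eq_log : elog = ENNReal.log := rfl

theorem inv_mul_elog_le_iff {n : ℕ} (hn : n ≠ 0) {z : ℝ≥0∞} {t : ℝ} :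
    (((n : ℝ)⁻¹ : ℝ) : EReal) * elog z ≤ t ↔ z ≤ ENNReal.ofReal (Real.exp (n * t)) := by
  have hpos : (0 : ℝ) < n := by exact_mod_cast hn.bot_lt
  rcases eq_or_ne z 0 with rfl | h0
  · rw [elog, if_pos rfl, EReal.coe_mul_bot_of_pos (inv_pos.2 hpos)]
    simp
  rcases eq_or_ne z ⊤ with rfl | htop
  · rw [elog, if_neg h0, if_pos rfl, EReal.coe_mul_top_of_pos (inv_pos.2 hpos)]
    simp
  rw [elog, if_neg h0, if_neg htop, ← EReal.coe_mul, EReal.coe_le_coe_iff,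
    inv_mul_le_iff₀ hpos, Real.log_le_iff_le_exp (ENNReal.toReal_pos h0 htop),
    ENNReal.le_ofReal_iff_toReal_le htop (Real.exp_pos _).le]

theorem pressSepEps_mono {X₁ X₂ : Type*} [MetricSpace X₁] [MetricSpace X₂] {T₁ : X₁ → Set X₁}
    {T₂ : X₂ → Set X₂} {φ₁ : ↥(graph2 T₁) → ℝ} {φ₂ : ↥(graph2 T₂) → ℝ} {ε₁ ε₂ : ℝ}
    (h : ∀ n, sepSup T₁ φ₁ n ε₁ ≤ sepSup T₂ φ₂ n ε₂) :
    pressSepEps T₁ φ₁ ε₁ ≤ pressSepEps T₂ φ₂ ε₂ := by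
  refine limsup_le_limsup (Eventually.of_forall fun n => ?_)
  rw [elog_eq_log]
  exact mul_le_mul_of_nonneg_left (ENNReal.log_monotone (h n))
    (EReal.coe_nonneg.2 (inv_nonneg.2 (Nat.cast_nonneg n)))

theorem pressSepEps_le_pressure {X : Type*} [MetricSpace X] (T : X → Set X)
    (φ : ↥(graph2 T) → ℝ) {ε : ℝ} (hε : 0 < ε) : pressSepEps T φ ε ≤ pressure T φ := by
  refine le_limsup_of_frequently_le (Eventually.frequently ?_)
  filter_upwards [Ioo_mem_nhdsGT hε] with δ hδ
  refine pressSepEps_mono fun n => iSup_mono fun E => iSup_mono fun hE =>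
    iSup_le fun hsep => le_iSup_of_le (fun x hx y hy hne => ?_) le_rfl
  exact hδ.2.le.trans (hsep x hx y hy hne)

/-- If the restricted system has growth rate below `s` at every scale, then penalizing the
distance to `Y` strongly enough yields a block bound of rate `s + 2η` for `T`. -/
theorem IsCorrespondence.exists_penalty_block {X : Type*} [MetricSpace X] [CompactSpace X]
    {T : X → Set X} (hT : IsCorrespondence T) {Y : Set X} (hYc : IsClosed Y)
    (hYne : Y.Nonempty) {φ : ↥(graph2 T) → ℝ} (hφ : Continuous φ) {s η ε : ℝ} (hη : 0 < η)
    (hε : 0 < ε)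
    (hs : ∀ δ > 0, ∀ᶠ m : ℕ in atTop, sepSup (restrictCorr T Y) (restrictPot T Y φ) m δ ≤
      ENNReal.ofReal (Real.exp (m * s))) :
    ∃ L : ℝ, 0 ≤ L ∧ ∃ M : ℕ, 0 < M ∧ ∀ n,
      orbitSup T (fun p => ext2 T φ p - L * Metric.infDist p.1 Y) ε (M + n) ≤
        ENNReal.ofReal (Real.exp (M * (s + 2 * η))) *
          orbitSup T (fun p => ext2 T φ p - L * Metric.infDist p.1 Y) ε n := by
  obtain ⟨C, hC0, hC⟩ := hT.exists_abs_ext2_le hφ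
  obtain ⟨ρ₀, hρ₀, hmod⟩ := hT.exists_modulus hφ hη
  obtain ⟨ρ, hρ, hρ₀', hρε⟩ : ∃ ρ > 0, ρ ≤ ρ₀ ∧ ρ ≤ ε / 2 :=
    ⟨min ρ₀ (ε / 2), lt_min hρ₀ (half_pos hε), min_le_left _ _, min_le_right _ _⟩
  obtain ⟨m, hm, hmη⟩ := ((hs (ρ / 2) (half_pos hρ)).and
    ((tendsto_natCast_atTop_atTop.atTop_mul_const hη).eventually_ge_atTop
      (C + Real.log 2 - s - 2 * η))).exists
  obtain ⟨F, hFsub, hFsep, hFmax⟩ := exists_maximal_eSep (ε := ρ / 2)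
    (finOrbits (restrictCorr T Y) m)
  obtain ⟨r, hr, hshadow⟩ := hT.exists_shadow hYc hYne m (half_pos hρ)
  obtain ⟨t, ht⟩ := exists_finset_dist_lt X (half_pos hε)
  obtain ⟨b, hb⟩ : ∃ b : ℝ,
      (Fintype.card (Fin (m + 1) → t) : ℝ) * Real.exp ((m + 1) * C) ≤ Real.exp b :=
    (Real.tendsto_exp_atTop.eventually_ge_atTop _).exists
  obtain ⟨L, hL0, hL⟩ : ∃ L : ℝ, 0 ≤ L ∧ b - L * r ≤ m * s := by
    refine ⟨max 0 ((b - m * s) / r), le_max_left _ _, ?_⟩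
    have := (div_le_iff₀ hr).1 (le_max_right 0 ((b - m * s) / r))
    linarith
  refine ⟨L, hL0, m + 1, m.succ_pos, fun n => ?_⟩
  let B : F ⊕ (Fin (m + 1) → t) → Set (ℕ → X) := Sum.elim
    (fun w => {x | ∀ i : Fin (m + 1), dist (x i) (w.1 i) < ρ})
    (fun j => {x | (∀ i : Fin (m + 1), dist (x i) (j i) < ε / 2) ∧
      ∃ i : Fin (m + 1), r ≤ Metric.infDist (x i) Y})
  let c : F ⊕ (Fin (m + 1) → t) → ℝ≥0∞ := Sum.elim
    (fun w => ENNReal.ofReal (Real.exp (C + m * η)) *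
      ENNReal.ofReal (Real.exp (birkhoff (restrictCorr T Y) (restrictPot T Y φ) w.1)))
    (fun _ => ENNReal.ofReal (Real.exp ((m + 1) * C - L * r)))
  have hcov : ∀ x ∈ orbitSpace T, ∃ j, x ∈ B j := by
    intro x hx
    by_cases hnear : ∀ i : Fin (m + 1), Metric.infDist (x i) Y < r
    · obtain ⟨y, hy, hxy⟩ := hshadow (fun i => x i) (fun i => hx i) hnear
      obtain ⟨w, hw, hyw⟩ : ∃ w ∈ F, dist y w < ρ / 2 := by
        rcases hFmax y hy with h | h
        · exact ⟨y, h, by simpa using hρ⟩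
        · exact h
      refine ⟨Sum.inl ⟨w, hw⟩, fun i => ?_⟩
      have h1 : dist (y i : X) (w i) < ρ / 2 := (dist_le_pi_dist y w i).trans_lt hyw
      have h2 := hxy i
      have h3 := dist_triangle (x i) (y i) (w i)
      linarith
    · push Not at hnear
      choose j hj hxj using fun i : Fin (m + 1) => ht (x i)
      exact ⟨Sum.inr fun i => ⟨j i, hj i⟩, hxj, hnear⟩
  have hsmall : ∀ j, ∀ x ∈ B j, ∀ y ∈ B j, ∀ i < m + 1, dist (x i) (y i) < ε := by
    rintro (w | j) x hx y hy i hi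
    · have h1 := hx ⟨i, hi⟩
      have h2 := hy ⟨i, hi⟩
      have h3 := dist_triangle_right (x i) (y i) (w.1 ⟨i, hi⟩)
      dsimp only at h1 h2
      linarith
    · have h1 := hx.1 ⟨i, hi⟩
      have h2 := hy.1 ⟨i, hi⟩
      have h3 := dist_triangle_right (x i) (y i) (j ⟨i, hi⟩)
      dsimp only at h1 h2
      linarith
  have hc : ∀ j, ∀ x ∈ B j, x ∈ orbitSpace T →
      seqWeight (fun p => ext2 T φ p - L * Metric.infDist p.1 Y) (m + 1) x ≤ c j := by
    rintro (w | j) x hx hxT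
    · simp only [c, Sum.elim_inl]
      rw [← ENNReal.ofReal_mul (Real.exp_pos _).le, ← Real.exp_add]
      refine ENNReal.ofReal_le_ofReal (Real.exp_le_exp.2 ?_)
      have h1 : ∑ i ∈ Finset.range (m + 1),
          (ext2 T φ (x i, x (i + 1)) - L * Metric.infDist (x i) Y) ≤
          ∑ i ∈ Finset.range (m + 1), ext2 T φ (x i, x (i + 1)) :=
        Finset.sum_le_sum fun i _ =>
          sub_le_self _ (mul_nonneg hL0 Metric.infDist_nonneg)
      have h2 : ∑ i ∈ Finset.range m, ext2 T φ (x i, x (i + 1)) ≤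
          m * η + birkhoff (restrictCorr T Y) (restrictPot T Y φ) w.1 := by
        rw [← Fin.sum_univ_eq_sum_range (fun i => ext2 T φ (x i, x (i + 1)))]
        calc ∑ i : Fin m, ext2 T φ (x i, x (i + 1))
            ≤ ∑ i : Fin m, (η + ext2 T φ (w.1 i.castSucc, w.1 i.succ)) := by
              refine Finset.sum_le_sum fun i _ => hmod _ (hxT i) _ (hFsub w.2 i) ?_
              exact (max_lt (hx i.castSucc) (hx i.succ)).trans_le hρ₀'
          _ = m * η + birkhoff (restrictCorr T Y) (restrictPot T Y φ) w.1 := by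
              simp [Finset.sum_add_distrib, birkhoff, ext2_restrict]
      rw [Finset.sum_range_succ (fun i => ext2 T φ (x i, x (i + 1)))] at h1
      have h3 := (abs_le.1 (hC (x m, x (m + 1)))).2
      linarith
    · refine ENNReal.ofReal_le_ofReal (Real.exp_le_exp.2 ?_)
      obtain ⟨i₀, hi₀⟩ := hx.2
      have h1 : Metric.infDist (x i₀) Y ≤ ∑ i ∈ Finset.range (m + 1), Metric.infDist (x i) Y :=
        Finset.single_le_sum (f := fun i => Metric.infDist (x i) Y)
          (fun _ _ => Metric.infDist_nonneg) (Finset.mem_range.2 i₀.2)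
      have h2 : ∑ i ∈ Finset.range (m + 1), ext2 T φ (x i, x (i + 1)) ≤ (m + 1) * C := by
        refine (Finset.sum_le_card_nsmul _ _ C fun i _ => (abs_le.1 (hC _)).2).trans_eq ?_
        simp
      have h3 := mul_le_mul_of_nonneg_left (hi₀.trans h1) hL0
      rw [Finset.sum_sub_distrib, ← Finset.mul_sum]
      linarith
  refine (orbitSup_add_le hε B c hcov hsmall hc n).trans (mul_le_mul_left ?_ _)
  have hgood : ∑' w : F, c (Sum.inl w) ≤ ENNReal.ofReal (Real.exp (C + m * η + m * s)) := by
    simp only [c, Sum.elim_inl]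
    rw [ENNReal.tsum_mul_left, Real.exp_add (C + m * η) (m * s), ENNReal.ofReal_mul (Real.exp_pos _).le]
    refine mul_le_mul_right (le_trans ?_ hm) _
    exact le_iSup_of_le F (le_iSup_of_le hFsub (le_iSup_of_le hFsep le_rfl))
  have hbad : ∑' j : Fin (m + 1) → t, c (Sum.inr j) ≤ ENNReal.ofReal (Real.exp (m * s)) := by
    simp only [c, Sum.elim_inr]
    rw [tsum_fintype, Finset.sum_const, nsmul_eq_mul, Finset.card_univ,
      ← ENNReal.ofReal_natCast, ← ENNReal.ofReal_mul (Nat.cast_nonneg _)]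
    refine ENNReal.ofReal_le_ofReal ?_
    rw [sub_eq_add_neg, Real.exp_add, ← mul_assoc]
    refine (mul_le_mul_of_nonneg_right hb (Real.exp_pos _).le).trans ?_
    rw [← Real.exp_add]
    exact Real.exp_le_exp.2 (by linarith)
  rw [Summable.tsum_sum ENNReal.summable ENNReal.summable]
  refine (add_le_add hgood hbad).trans ?_
  rw [← ENNReal.ofReal_add (Real.exp_pos _).le (Real.exp_pos _).le]
  refine ENNReal.ofReal_le_ofReal ?_
  have h1 : Real.exp (m * s) ≤ Real.exp (C + m * η + m * s) :=
    Real.exp_le_exp.2 (by nlinarith [mul_nonneg (Nat.cast_nonneg (α := ℝ) m) hη.le])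
  have h2 : Real.exp (Real.log 2 + (C + m * η + m * s)) ≤
      Real.exp (((m + 1 : ℕ) : ℝ) * (s + 2 * η)) := by
    refine Real.exp_le_exp.2 ?_
    push_cast
    linarith
  rw [Real.exp_add, Real.exp_log two_pos] at h2
  linarith

theorem pressSepEps_le_of_pressure_restrict_lt
    {X : Type*} [MetricSpace X] [CompactSpace X] [MeasurableSpace X] [BorelSpace X]
    {T : X → Set X} (hT : IsCorrespondence T) {Y : Set X} (hYne : Y.Nonempty)
    (hYc : IsClosed Y) {φ : ↥(graph2 T) → ℝ} (hφ : Continuous φ)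
    (hfull : ∀ μ : Measure X, IsProbabilityMeasure μ →
      (∃ Q : X → Measure X, IsTransKernel Q ∧ SupportedBy T Q ∧ μ.bind Q = μ) → μ Y = 1)
    {s η ε : ℝ} (hη : 0 < η) (hε : 0 < ε)
    (hs : pressure (restrictCorr T Y) (restrictPot T Y φ) < s) :
    pressSepEps T φ ε ≤ ((s + 4 * η : ℝ) : EReal) := by
  obtain ⟨C, hC0, hC⟩ := hT.exists_abs_ext2_le hφ
  obtain ⟨L, hL0, M, hM, hblock⟩ := hT.exists_penalty_block hYc hYne hφ hη hε (s := s) (by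
    intro δ hδ
    have h := eventually_lt_of_limsup_lt ((pressSepEps_le_pressure _ _ hδ).trans_lt hs)
    filter_upwards [h, eventually_ne_atTop 0] with m hm hm0
    exact (inv_mul_elog_le_iff hm0).1 hm.le)
  obtain ⟨D, hD⟩ := exists_orbitSup_le_exp_add hε (C := C)
    (fun p => (sub_le_self _ (mul_nonneg hL0 Metric.infDist_nonneg)).trans (abs_le.1 (hC p)).2)
    hM hblock
  have hδ : 0 < η / (L + 1) := div_pos hη (by linarith)
  obtain ⟨N, hN⟩ := hT.exists_forall_sum_infDist_le hfull hYc hδ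
  have hLδ : L * (η / (L + 1)) ≤ η := by
    rw [mul_div_assoc', div_le_iff₀ (by linarith)]
    nlinarith
  refine limsup_le_of_le (by isBoundedDefault) ?_
  filter_upwards [eventually_ge_atTop N, eventually_ne_atTop 0,
    (tendsto_natCast_atTop_atTop.atTop_mul_const hη).eventually_ge_atTop
      (C + η + D + s + 2 * η)] with n hnN hn0 hnη
  rw [inv_mul_elog_le_iff hn0]
  refine (sepSup_le_orbitSup (a := C + η * (n + 1)) hT.1 hε φ fun x hx => ?_).trans
    ((mul_le_mul_right (hD (n + 1)) _).trans ?_)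
  · have h1 := hN (n + 1) (by omega) x hx
    have h2 : L * ∑ i ∈ Finset.range (n + 1), Metric.infDist (x i) Y ≤ η * (n + 1) := by
      refine (mul_le_mul_of_nonneg_left h1 hL0).trans ?_
      rw [← mul_assoc]
      push_cast
      exact mul_le_mul_of_nonneg_right hLδ (by positivity)
    rw [Finset.sum_sub_distrib, ← Finset.mul_sum,
      Finset.sum_range_succ (fun i => ext2 T φ (x i, x (i + 1)))]
    have h3 := (abs_le.1 (hC (x n, x (n + 1)))).1
    linarith
  · rw [← ENNReal.ofReal_mul (Real.exp_pos _).le, ← Real.exp_add]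
    refine ENNReal.ofReal_le_ofReal (Real.exp_le_exp.2 ?_)
    push_cast
    linarith

/-- Pressure is unchanged by restriction to a nonempty closed subset `Y` carrying all
invariant measures of kernels supported by `T`. -/
theorem pressure_restrict_full_subset
    {X : Type*} [MetricSpace X] [CompactSpace X] [MeasurableSpace X] [BorelSpace X]
    (T : X → Set X) (hT : IsCorrespondence T)
    (Y : Set X) (hYne : Y.Nonempty) (hYc : IsClosed Y)
    (hTY : IsCorrespondence fun y : ↥Y => {z : ↥Y | (z : X) ∈ T y})
    (φ : ↥(graph2 T) → ℝ) (hφ : Continuous φ)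
    (hfull : ∀ μ : Measure X, IsProbabilityMeasure μ →
      (∃ Q : X → Measure X, IsTransKernel Q ∧ SupportedBy T Q ∧ μ.bind Q = μ) →
      μ Y = 1) :
    pressure T φ =
      pressure (fun y : ↥Y => {z : ↥Y | (z : X) ∈ T y})
        (fun q : ↥(graph2 fun y : ↥Y => {z : ↥Y | (z : X) ∈ T y}) =>
          φ ⟨((q.1.1 : X), (q.1.2 : X)), q.2⟩) := by
  refine le_antisymm (le_of_forall_gt_imp_ge_of_dense fun c hc => ?_) ?_
  · obtain ⟨s, hs, hsc⟩ := EReal.lt_iff_exists_real_btwn.1 hc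
    obtain ⟨u, hsu, huc⟩ := EReal.lt_iff_exists_real_btwn.1 hsc
    have hη : 0 < (u - s) / 4 := by
      have := EReal.coe_lt_coe_iff.1 hsu
      linarith
    refine limsup_le_of_le (by isBoundedDefault) ?_
    filter_upwards [self_mem_nhdsWithin] with ε hε
    refine (pressSepEps_le_of_pressure_restrict_lt hT hYne hYc hφ hfull hη hε hs).trans ?_
    rw [show s + 4 * ((u - s) / 4) = u by ring]
    exact huc.le
  · exact limsup_le_limsup (Eventually.of_forall fun ε =>
      pressSepEps_mono fun n => sepSup_restrict_le T Y φ n ε)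

end Corr
end

section
/- Forward expansiveness transfers between a correspondence and the induced shift: Let T be a correspondence on a compact metric space (X,d) and σ the shift map on the orbit space (O_ω(T), d_ω). (i) If T is forward expansive with expansive constant ε > 0, then the single-valued map σ is forward expansive with expansive constant ε/(2(1+ε)), i.e., for every pair of distinct points x, y ∈ O_ω(T) there exists n ∈ ℕ₀ with d_ω(σⁿ(x), σⁿ(y)) > ε/(2(1+ε)). (ii) Conversely, if σ is forward expansive with expansive constant ε ∈ (0,1), then T is forward expansive with expansive constant ε/(1−ε). -/
open Filter MeasureTheory Set
open scoped Topology ENNReal Classical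

namespace Corr

theorem iterate_shiftOrb_apply {X : Type*} (T : X → Set X) (n : ℕ) (x : ↥(orbitSpace T))
    (k : ℕ) :
    ((shiftOrb T)^[n] x).1 k = x.1 (n + k) := by
  induction n generalizing x with
  | zero => simp
  | succ n ih =>
    rw [Function.iterate_succ_apply, ih]
    exact congrArg x.1 (by omega : n + k + 1 = n + 1 + k)

theorem hasSum_half_pow_succ : HasSum (fun k : ℕ => (1 / 2 : ℝ) ^ (k + 1)) 1 := by
  simpa [pow_succ, div_eq_mul_inv] using hasSum_geometric_two.mul_right (1 / 2 : ℝ)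

theorem summable_dOmega {X : Type*} [MetricSpace X] (x y : ℕ → X) :
    Summable fun k : ℕ =>
      (1 / 2 : ℝ) ^ (k + 1) * (dist (x k) (y k) / (1 + dist (x k) (y k))) := by
  refine hasSum_half_pow_succ.summable.of_nonneg_of_le (fun k => by positivity) fun k => ?_
  refine mul_le_of_le_one_right (by positivity) ?_
  rw [div_le_one (by positivity)]
  linarith

theorem half_mul_le_dOmega {X : Type*} [MetricSpace X] (x y : ℕ → X) :
    1 / 2 * (dist (x 0) (y 0) / (1 + dist (x 0) (y 0))) ≤ dOmega x y := by
  simpa [dOmega] using (summable_dOmega x y).le_tsum 0 fun k _ => by positivity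

theorem dOmega_le_of_forall_dist_le {X : Type*} [MetricSpace X] {x y : ℕ → X} {ε : ℝ}
    (hε : ε < 1) (h : ∀ k, dist (x k) (y k) ≤ ε / (1 - ε)) : dOmega x y ≤ ε := by
  have hsum : HasSum (fun k : ℕ => (1 / 2 : ℝ) ^ (k + 1) * ε) ε := by
    simpa using hasSum_half_pow_succ.mul_right ε
  refine ((summable_dOmega x y).tsum_le_tsum (fun k => ?_) hsum.summable).trans_eq hsum.tsum_eq
  refine mul_le_mul_of_nonneg_left ?_ (by positivity)
  have hk := h k
  rw [le_div_iff₀ (by linarith)] at hk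
  rw [div_le_iff₀ (by positivity)]
  linarith

/-- Forward expansiveness transfers between a correspondence `T` and the induced shift
`σ` on `(O_ω(T), d_ω)`: (i) if `T` is forward expansive with constant `ε`, then `σ` is
forward expansive with constant `ε/(2(1+ε))`; (ii) conversely, if `σ` is forward
expansive with constant `ε ∈ (0,1)`, then `T` is forward expansive with constant
`ε/(1-ε)`. -/
theorem forward_expansive_transfer
    {X : Type*} [MetricSpace X] [CompactSpace X]
    (T : X → Set X) (hT : IsCorrespondence T) :
    (∀ ε : ℝ, IsFwdExpansiveWith T ε →
      ∀ x y : ↥(orbitSpace T), x ≠ y → ∃ n : ℕ,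
        ε / (2 * (1 + ε)) < dOmega ((shiftOrb T)^[n] x).1 ((shiftOrb T)^[n] y).1) ∧
    (∀ ε : ℝ, 0 < ε → ε < 1 →
      (∀ x y : ↥(orbitSpace T), x ≠ y → ∃ n : ℕ,
        ε < dOmega ((shiftOrb T)^[n] x).1 ((shiftOrb T)^[n] y).1) →
      IsFwdExpansiveWith T (ε / (1 - ε))) := by
  refine ⟨fun ε ⟨hε, h⟩ x y hxy => ?_, fun ε hε hε1 h => ⟨div_pos hε (by linarith), ?_⟩⟩
  · obtain ⟨n, hn⟩ := h x.1 x.2 y.1 y.2 (Subtype.coe_injective.ne hxy)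
    refine ⟨n, lt_of_lt_of_le ?_ (half_mul_le_dOmega _ _)⟩
    simp only [iterate_shiftOrb_apply, add_zero]
    rw [div_mul_div_comm, one_mul, div_lt_div_iff₀ (by positivity) (by positivity)]
    linarith
  · intro x hx y hy hxy
    by_contra! hle
    obtain ⟨n, hn⟩ := h ⟨x, hx⟩ ⟨y, hy⟩ fun heq => hxy (congrArg Subtype.val heq)
    refine hn.not_ge (dOmega_le_of_forall_dist_le hε1 fun k => ?_)
    simpa only [iterate_shiftOrb_apply] using hle (n + k)

end Corr
end
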